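/- Let {u_k} ⊆ BV(ℝ^N) and u ∈ BV(ℝ^N) with ‖u_k − u‖_BV := ‖u_k − u‖_{L^1} + V(u_k − u, ℝ^N) → 0. Then there exists a subsequence {u_{k_j}} such that the approximate upper limits satisfy u_{k_j}^+(x) → u^+(x) for H^{N-1}-almost every x ∈ ℝ^N. -/

import Mathlib

open MeasureTheory Metric Filter Set
open scoped ENNReal Topology symmDiff

noncomputable section

abbrev Euc (N : ℕ) : Type := EuclideanSpace ℝ (Fin N)

variable {N : ℕ}

/-- The divergence of a vector field `φ : ℝ^N → ℝ^N`. -/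
def diverg (φ : Euc N → Euc N) (x : Euc N) : ℝ :=
  ∑ i : Fin N, fderiv ℝ φ x (EuclideanSpace.single i 1) i

/-- The admissible test vector fields for the variation in `Ω`:
`C^1`, compactly supported in `Ω`, with `‖φ‖ ≤ 1`. -/
def TestVF (Ω : Set (Euc N)) : Set (Euc N → Euc N) :=
  {φ | ContDiff ℝ 1 φ ∧ HasCompactSupport φ ∧ tsupport φ ⊆ Ω ∧ ∀ x, ‖φ x‖ ≤ 1}

/-- The total variation `V(u, Ω)`. -/
def variation (u : Euc N → ℝ) (Ω : Set (Euc N)) : ℝ≥0∞ :=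
  ⨆ φ ∈ TestVF Ω, ENNReal.ofReal (∫ x in Ω, u x * diverg φ x)

/-- The perimeter `P(A, Ω)` of `A` in `Ω`. -/
def perimeter (A Ω : Set (Euc N)) : ℝ≥0∞ :=
  ⨆ φ ∈ TestVF Ω, ENNReal.ofReal (∫ x in A, diverg φ x)

/-- `u ∈ BV(Ω)`. -/
def MemBV (u : Euc N → ℝ) (Ω : Set (Euc N)) : Prop :=
  IntegrableOn u Ω volume ∧ variation u Ω < ⊤

/-- `u ∈ BV_loc(Ω)`. -/
def MemBVloc (u : Euc N → ℝ) (Ω : Set (Euc N)) : Prop :=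
  ∀ Ω' : Set (Euc N), IsOpen Ω' → IsCompact (closure Ω') → closure Ω' ⊆ Ω → MemBV u Ω'

/-- `u ∈ GBV(Ω)`: measurable, and every truncation `(-m) ∨ u ∧ m` is in `BV_loc(Ω)`. -/
def MemGBV (u : Euc N → ℝ) (Ω : Set (Euc N)) : Prop :=
  AEMeasurable u (volume.restrict Ω) ∧
    ∀ m : ℝ, 0 < m → MemBVloc (fun x => max (-m) (min (u x) m)) Ω

/-- `A` has locally finite perimeter in `Ω`. -/
def HasLocFinPerimeter (A Ω : Set (Euc N)) : Prop :=
  ∀ Ω' : Set (Euc N), IsOpen Ω' → IsCompact (closure Ω') → closure Ω' ⊆ Ω →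
    perimeter A Ω' < ⊤

/-- `A` has density `t` at `x`. -/
def HasDensity (A : Set (Euc N)) (x : Euc N) (t : ℝ) : Prop :=
  Tendsto (fun ρ : ℝ => volume (A ∩ ball x ρ) / volume (ball x ρ)) (𝓝[>] 0)
    (𝓝 (ENNReal.ofReal t))

/-- The approximate upper limit `u⁺(x)` of `u` at `x` (relative to `Ω`), with `inf ∅ = ⊤`. -/
def approxUpper (u : Euc N → ℝ) (Ω : Set (Euc N)) (x : Euc N) : EReal :=
  sInf {t : EReal | ∃ s : ℝ, t = (s : EReal) ∧ HasDensity {y | y ∈ Ω ∧ s < u y} x 0}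

/-- The approximate lower limit `u⁻(x)` of `u` at `x` (relative to `Ω`), with `sup ∅ = ⊥`. -/
def approxLower (u : Euc N → ℝ) (Ω : Set (Euc N)) (x : Euc N) : EReal :=
  sSup {t : EReal | ∃ s : ℝ, t = (s : EReal) ∧ HasDensity {y | y ∈ Ω ∧ u y < s} x 0}

/-- The approximate limit `ũ(x)` exists (i.e. `u⁺(x) = u⁻(x)`) and is `+∞`. -/
def HasApproxLimitTop (u : Euc N → ℝ) (Ω : Set (Euc N)) (x : Euc N) : Prop :=
  approxUpper u Ω x = ⊤ ∧ approxLower u Ω x = ⊤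

/-- The approximate limit `ũ(x)` exists and `|ũ(x)| = +∞`. -/
def HasInfApproxLimit (u : Euc N → ℝ) (Ω : Set (Euc N)) (x : Euc N) : Prop :=
  (approxUpper u Ω x = ⊤ ∧ approxLower u Ω x = ⊤) ∨
    (approxUpper u Ω x = ⊥ ∧ approxLower u Ω x = ⊥)

/-- `C` is `L⁰`-polar in `Ω`. -/
def L0Polar (C Ω : Set (Euc N)) : Prop :=
  ∃ u : Euc N → ℝ, AEMeasurable u (volume.restrict Ω) ∧
    C ⊆ {x | x ∈ Ω ∧ HasInfApproxLimit u Ω x}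

/-- `C` is `BV`-polar in `Ω`. -/
def BVPolar (C Ω : Set (Euc N)) : Prop :=
  ∃ u : Euc N → ℝ, MemBV u Ω ∧ C ⊆ {x | x ∈ Ω ∧ HasInfApproxLimit u Ω x}

/-- `C` is `GBV`-polar in `Ω`. -/
def GBVPolar (C Ω : Set (Euc N)) : Prop :=
  ∃ u : Euc N → ℝ, MemGBV u Ω ∧ C ⊆ {x | x ∈ Ω ∧ HasInfApproxLimit u Ω x}

/-- The set `A^{(1)}` of points of `Ω` where `A` has density `1`. -/
def densityOne (A Ω : Set (Euc N)) : Set (Euc N) :=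
  {x | x ∈ Ω ∧ HasDensity A x 1}

/-- The `(N-1)`-dimensional Hausdorff content. -/
def hcont (N : ℕ) : OuterMeasure (Euc N) :=
  OuterMeasure.mkMetric'.pre (fun s => ediam s ^ ((N : ℝ) - 1)) ⊤

theorem hcont_apply (s : Set (Euc N)) : hcont N s =
    ⨅ (t : ℕ → Set (Euc N)) (_ : s ⊆ ⋃ n, t n),
      ∑' n, ⨆ _ : (t n).Nonempty, ediam (t n) ^ ((N : ℝ) - 1) := by
  unfold hcont OuterMeasure.mkMetric'.pre
  rw [OuterMeasure.boundedBy_apply]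
  simp [extend]

theorem hcont_le (s : Set (Euc N)) : hcont N s ≤ ediam s ^ ((N : ℝ) - 1) :=
  OuterMeasure.mkMetric'.pre_le le_top

theorem hausdorff_zero_of_hcont (hN : 1 ≤ N) {s : Set (Euc N)} (h : hcont N s = 0) :
    (μH[(N : ℝ) - 1] : Measure (Euc N)) s = 0 := by
  rw [hcont_apply] at h
  have hd : (0 : ℝ) ≤ (N : ℝ) - 1 := by
    have : (1 : ℝ) ≤ N := by exact_mod_cast hN
    linarith
  rw [Measure.hausdorffMeasure_apply]
  simp only [ENNReal.iSup_eq_zero]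
  intro r hr
  refine le_antisymm (ENNReal.le_of_forall_pos_le_add fun ε hε _ => ?_) bot_le
  rw [zero_add]
  have hpos : 0 < min (ε : ℝ≥0∞) (min 1 (r ^ ((N : ℝ) - 1))) := by
    refine lt_min (by exact_mod_cast hε) (lt_min one_pos ?_)
    rcases hd.eq_or_lt with h0 | h0
    · rw [← h0]; simp
    · by_cases hrt : r = ⊤
      · rw [hrt, ENNReal.top_rpow_of_pos h0]; simp
      · exact ENNReal.rpow_pos hr hrt
  rw [← h] at hpos
  obtain ⟨t, ht⟩ := iInf_lt_iff.1 hpos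
  obtain ⟨hst, ht⟩ := iInf_lt_iff.1 ht
  refine iInf₂_le_of_le t hst (iInf_le_of_le ?_ (ht.le.trans (min_le_left _ _)))
  intro n
  rcases (t n).eq_empty_or_nonempty with he | hne
  · simp [he]
  have h1 : ediam (t n) ^ ((N : ℝ) - 1) < min (ε : ℝ≥0∞) (min 1 (r ^ ((N : ℝ) - 1))) := by
    refine lt_of_le_of_lt ?_ ht
    refine le_trans ?_ (ENNReal.le_tsum n)
    exact le_iSup (fun _ : (t n).Nonempty => ediam (t n) ^ ((N : ℝ) - 1)) hne
  rcases hd.eq_or_lt with h0 | h0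
  · rw [← h0] at h1
    simp at h1
  · have h2 := h1.trans_le ((min_le_right _ _).trans (min_le_right _ _))
    exact ((ENNReal.rpow_lt_rpow_iff h0).1 h2).le

/-- Covering lemma. -/
theorem hcont_cover (hN : 1 ≤ N) (S : Set (Euc N)) (ρ : Euc N → ℝ) (R : ℝ)
    (hρ : ∀ x ∈ S, 0 < ρ x ∧ ρ x ≤ R) (T : ℝ≥0∞)
    (hT : ∀ F : Finset (Euc N), (∀ x ∈ F, x ∈ S) →
      (F : Set (Euc N)).PairwiseDisjoint (fun x => closedBall x (ρ x)) →
      ∑ x ∈ F, ENNReal.ofReal (ρ x) ^ ((N : ℝ) - 1) ≤ T) :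
    hcont N S ≤ 10 ^ ((N : ℝ) - 1) * T := by
  have hd : (0 : ℝ) ≤ (N : ℝ) - 1 := by
    have : (1 : ℝ) ≤ N := by exact_mod_cast hN
    linarith
  obtain ⟨u, huS, hdis, hcov⟩ := Vitali.exists_disjoint_subfamily_covering_enlargement_closedBall
    S (fun x => x) ρ R (fun a ha => (hρ a ha).2) 5 (by norm_num)
  have hucount : u.Countable := by
    apply hdis.countable_of_nonempty_interior
    intro x hx
    exact ⟨x, ball_subset_interior_closedBall (mem_ball_self (hρ x (huS hx)).1)⟩
  have hsub : S ⊆ ⋃ x ∈ u, closedBall x (5 * ρ x) := by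
    intro a ha
    obtain ⟨b, hb, hab⟩ := hcov a ha
    exact mem_biUnion hb (hab (mem_closedBall_self (hρ a ha).1.le))
  calc hcont N S ≤ hcont N (⋃ x ∈ u, closedBall x (5 * ρ x)) := measure_mono hsub
    _ ≤ ∑' x : u, hcont N (closedBall (x : Euc N) (5 * ρ x)) := measure_biUnion_le _ hucount _
    _ ≤ ∑' x : u, 10 ^ ((N : ℝ) - 1) * ENNReal.ofReal (ρ x) ^ ((N : ℝ) - 1) := by
        refine ENNReal.tsum_le_tsum fun x => (hcont_le _).trans ?_
        rw [← ENNReal.mul_rpow_of_nonneg _ _ hd]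
        refine ENNReal.rpow_le_rpow ?_ hd
        rw [← closedEBall_ofReal (by linarith [(hρ x (huS x.2)).1])]
        refine ediam_closedEBall_le.trans ?_
        rw [ENNReal.ofReal_mul (by norm_num), ← mul_assoc]
        gcongr
        norm_num
    _ = 10 ^ ((N : ℝ) - 1) * ∑' x : u, ENNReal.ofReal (ρ x) ^ ((N : ℝ) - 1) := ENNReal.tsum_mul_left
    _ ≤ 10 ^ ((N : ℝ) - 1) * T := by
        gcongr
        rw [ENNReal.tsum_eq_iSup_sum]
        refine iSup_le fun F => ?_
        have := hT (F.map (Function.Embedding.subtype _)) (by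
          intro x hx
          simp at hx
          exact huS hx.1) (by
          refine hdis.subset ?_
          intro x hx
          simp at hx
          exact hx.1)
        simpa using this

theorem diverg_continuous {φ : Euc N → Euc N} (h : ContDiff ℝ 1 φ) : Continuous (diverg φ) := by
  unfold diverg
  have := h.continuous_fderiv (by norm_num)
  fun_prop

theorem diverg_zero_off {φ : Euc N → Euc N} {x : Euc N} (hx : x ∉ tsupport φ) :
    diverg φ x = 0 := by
  have : fderiv ℝ φ x = 0 := by
    by_contra hne
    exact hx (support_fderiv_subset ℝ (f := φ) (by simpa using hne))
  simp [diverg, this]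

theorem diverg_compact {φ : Euc N → Euc N} (h : HasCompactSupport φ) :
    HasCompactSupport (diverg φ) :=
  HasCompactSupport.intro h fun _ hx => diverg_zero_off hx

theorem diverg_add {φ ψ : Euc N → Euc N} (h : ContDiff ℝ 1 φ) (h' : ContDiff ℝ 1 ψ) :
    diverg (φ + ψ) = diverg φ + diverg ψ := by
  ext x
  have h1 := (h.differentiable (by norm_num)) x
  have h2 := (h'.differentiable (by norm_num)) x
  simp [diverg, fderiv_add h1 h2, Finset.sum_add_distrib]

theorem diverg_const_smul (c : ℝ) {φ : Euc N → Euc N} (h : ContDiff ℝ 1 φ) :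
    diverg (c • φ) = c • diverg φ := by
  ext x
  have h1 := (h.differentiable (by norm_num)) x
  simp [diverg, fderiv_const_smul h1, Finset.mul_sum]

theorem diverg_smul {f : Euc N → ℝ} {φ : Euc N → Euc N} (hf : ContDiff ℝ 1 f) (h : ContDiff ℝ 1 φ)
    (x : Euc N) :
    diverg (fun x => f x • φ x) x = f x * diverg φ x + fderiv ℝ f x (φ x) := by
  have h1 := (h.differentiable (by norm_num)) x
  have h2 := (hf.differentiable (by norm_num)) x
  have h3 : φ x = ∑ i, φ x i • EuclideanSpace.single i (1 : ℝ) := by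
    ext j
    simp [Finset.sum_apply, Pi.single_apply]
  conv_rhs => rw [h3]
  simp only [diverg]
  rw [fderiv_fun_smul h2 h1]
  simp [Finset.sum_add_distrib, Finset.mul_sum, mul_comm]

theorem integral_diverg {φ : Euc N → Euc N} (h : ContDiff ℝ 1 φ) (hc : HasCompactSupport φ) :
    ∫ x, diverg φ x = 0 := by
  have hcont := h.continuous_fderiv (by norm_num)
  have hcs : ∀ v : Euc N, ∀ i, HasCompactSupport (fun x => fderiv ℝ φ x v i) := by
    intro v i
    refine HasCompactSupport.intro hc fun x hx => ?_
    have : fderiv ℝ φ x = 0 := by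
      by_contra hne
      exact hx (support_fderiv_subset ℝ (f := φ) (by simpa using hne))
    simp [this]
  unfold diverg
  rw [integral_finsetSum]
  · refine Finset.sum_eq_zero fun i _ => ?_
    have hd : ∀ x, HasFDerivAt (fun x => φ x i)
        ((EuclideanSpace.proj i : Euc N →L[ℝ] ℝ).comp (fderiv ℝ φ x)) x := fun x =>
      (EuclideanSpace.proj i : Euc N →L[ℝ] ℝ).hasFDerivAt.comp x
        ((h.differentiable (by norm_num)) x).hasFDerivAt
    have hcsi : HasCompactSupport (fun x => φ x i) :=
      HasCompactSupport.intro hc fun x hx => by simp [image_eq_zero_of_notMem_tsupport hx]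
    have hInteg : Integrable (fun x => fderiv ℝ φ x (EuclideanSpace.single i 1) i) := by
      apply Continuous.integrable_of_hasCompactSupport _ (hcs _ _)
      fun_prop
    have hphi : Continuous (fun x => φ x i) := by
      have := h.continuous
      fun_prop
    have := integral_bilinear_hasLineDerivAt_right_eq_neg_left_of_integrable
      (μ := (volume : Measure (Euc N))) (f := fun _ => (1 : ℝ)) (f' := fun _ => (0 : ℝ))
      (g := fun x => φ x i) (g' := fun x => fderiv ℝ φ x (EuclideanSpace.single i 1) i)
      (v := EuclideanSpace.single i 1) (B := ContinuousLinearMap.mul ℝ ℝ)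
      (by simp) (by simpa using hInteg) (by simpa using hphi.integrable_of_hasCompactSupport hcsi)
      (fun x _ => by simpa using (hasFDerivAt_const (1 : ℝ) x).hasLineDerivAt _)
      (fun x _ => (hd x).hasLineDerivAt _)
    simpa using this
  · intro i _
    apply Continuous.integrable_of_hasCompactSupport _ (hcs _ _)
    fun_prop

theorem integrable_mul_diverg {u : Euc N → ℝ} (hu : Integrable u) {φ : Euc N → Euc N}
    (h : ContDiff ℝ 1 φ) (hc : HasCompactSupport φ) :
    Integrable (fun x => u x * diverg φ x) := by
  obtain ⟨C, hC⟩ := (diverg_continuous h).bounded_above_of_compact_support (diverg_compact hc)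
  exact hu.mul_bdd (c := C) (diverg_continuous h).aestronglyMeasurable (ae_of_all _ hC)

theorem setIntegral_testVF (u : Euc N → ℝ) {Ω : Set (Euc N)} {φ : Euc N → Euc N}
    (h : φ ∈ TestVF Ω) : ∫ x in Ω, u x * diverg φ x = ∫ x, u x * diverg φ x := by
  refine setIntegral_eq_integral_of_forall_compl_eq_zero fun x hx => ?_
  rw [diverg_zero_off (fun hx' => hx (h.2.2.1 hx')), mul_zero]

theorem le_variation (u : Euc N → ℝ) {Ω : Set (Euc N)} {φ : Euc N → Euc N}
    (h : φ ∈ TestVF Ω) : ENNReal.ofReal (∫ x, u x * diverg φ x) ≤ variation u Ω := by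
  rw [← setIntegral_testVF u h]
  exact le_iSup₂ (f := fun φ _ => ENNReal.ofReal (∫ x in Ω, u x * diverg φ x)) φ h

theorem variation_le {u : Euc N → ℝ} {Ω : Set (Euc N)} {T : ℝ≥0∞}
    (h : ∀ φ ∈ TestVF Ω, ENNReal.ofReal (∫ x, u x * diverg φ x) ≤ T) : variation u Ω ≤ T := by
  refine iSup₂_le fun φ hφ => ?_
  rw [setIntegral_testVF u hφ]
  exact h φ hφ

theorem TestVF_mono {Ω Ω' : Set (Euc N)} (h : Ω ⊆ Ω') : TestVF Ω ⊆ TestVF Ω' :=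
  fun _ hφ => ⟨hφ.1, hφ.2.1, hφ.2.2.1.trans h, hφ.2.2.2⟩

theorem variation_mono (u : Euc N → ℝ) {Ω Ω' : Set (Euc N)} (h : Ω ⊆ Ω') :
    variation u Ω ≤ variation u Ω' :=
  variation_le fun _ hφ => le_variation u (TestVF_mono h hφ)

theorem zero_TestVF (Ω : Set (Euc N)) : (0 : Euc N → Euc N) ∈ TestVF Ω :=
  ⟨contDiff_const, HasCompactSupport.zero, by simp [tsupport], by simp⟩

theorem add_TestVF {A B : Set (Euc N)} (hd : Disjoint A B) {φ ψ : Euc N → Euc N}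
    (hφ : φ ∈ TestVF A) (hψ : ψ ∈ TestVF B) : φ + ψ ∈ TestVF (A ∪ B) := by
  refine ⟨hφ.1.add hψ.1, hφ.2.1.add hψ.2.1,
    (tsupport_add _ _).trans (union_subset_union hφ.2.2.1 hψ.2.2.1), fun x => ?_⟩
  by_cases hx : x ∈ A
  · have : ψ x = 0 := image_eq_zero_of_notMem_tsupport
      fun h => disjoint_left.1 hd hx (hψ.2.2.1 h)
    simpa [this] using hφ.2.2.2 x
  · have : φ x = 0 := image_eq_zero_of_notMem_tsupport fun h => hx (hφ.2.2.1 h)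
    simpa [this] using hψ.2.2.2 x

theorem integral_add_diverg {u : Euc N → ℝ} (hu : Integrable u) {φ ψ : Euc N → Euc N}
    (h : ContDiff ℝ 1 φ) (hc : HasCompactSupport φ) (h' : ContDiff ℝ 1 ψ)
    (hc' : HasCompactSupport ψ) : ∫ x, u x * diverg (φ + ψ) x =
      (∫ x, u x * diverg φ x) + ∫ x, u x * diverg ψ x := by
  rw [← integral_add (integrable_mul_diverg hu h hc) (integrable_mul_diverg hu h' hc'),
    diverg_add h h']
  simp [mul_add]

theorem neg_TestVF {A : Set (Euc N)} {φ : Euc N → Euc N} (hφ : φ ∈ TestVF A) :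
    (-1 : ℝ) • φ ∈ TestVF A := by
  refine ⟨contDiff_const.smul hφ.1, ?_, ?_, fun x => ?_⟩
  · simpa using hφ.2.1.neg
  · simpa [tsupport] using hφ.2.2.1
  · simpa using hφ.2.2.2 x

theorem ofReal_add_le_of_nonneg {a b : ℝ} {T : ℝ≥0∞} (h1 : ENNReal.ofReal (a + b) ≤ T)
    (h2 : ENNReal.ofReal a ≤ T) (h3 : ENNReal.ofReal b ≤ T) :
    ENNReal.ofReal a + ENNReal.ofReal b ≤ T := by
  rcases le_total a 0 with ha | ha
  · simpa [ENNReal.ofReal_of_nonpos ha] using h3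
  rcases le_total b 0 with hb | hb
  · simpa [ENNReal.ofReal_of_nonpos hb] using h2
  rwa [← ENNReal.ofReal_add ha hb]

theorem variation_superadd {u : Euc N → ℝ} (hu : Integrable u) {A B : Set (Euc N)}
    (hd : Disjoint A B) : variation u A + variation u B ≤ variation u (A ∪ B) := by
  have key : ∀ φ, φ ∈ TestVF A → ∀ ψ, ψ ∈ TestVF B →
      ENNReal.ofReal (∫ x in A, u x * diverg φ x) + ENNReal.ofReal (∫ x in B, u x * diverg ψ x)
        ≤ variation u (A ∪ B) := by
    intro φ hφ ψ hψ
    rw [setIntegral_testVF u hφ, setIntegral_testVF u hψ]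
    refine ofReal_add_le_of_nonneg ?_ (le_variation u (TestVF_mono subset_union_left hφ))
      (le_variation u (TestVF_mono subset_union_right hψ))
    rw [← integral_add_diverg hu hφ.1 hφ.2.1 hψ.1 hψ.2.1]
    exact le_variation u (add_TestVF hd hφ hψ)
  exact ENNReal.biSup_add_biSup_le' ⟨0, zero_TestVF A⟩ ⟨0, zero_TestVF B⟩ key

theorem variation_sum {ι : Type*} {u : Euc N → ℝ} (hu : Integrable u) (U : ι → Set (Euc N))
    (F : Finset ι) (hd : (F : Set ι).PairwiseDisjoint U) :
    ∑ i ∈ F, variation u (U i) ≤ variation u (⋃ i ∈ F, U i) := by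
  classical
  induction F using Finset.induction_on with
  | empty => simp
  | insert a F ha ih =>
    rw [Finset.sum_insert ha, Finset.set_biUnion_insert]
    refine le_trans ?_ (variation_superadd hu ?_)
    · gcongr
      exact ih (hd.subset (by simp))
    · simp only [disjoint_iUnion_right]
      intro i hi
      refine hd (by simp) (by simp [hi]) ?_
      rintro rfl
      exact ha hi

theorem variation_neg (u : Euc N → ℝ) (Ω : Set (Euc N)) :
    variation (fun x => - u x) Ω = variation u Ω := by
  have key : ∀ u : Euc N → ℝ, variation (fun x => - u x) Ω ≤ variation u Ω := by
    intro u
    refine variation_le fun φ hφ => ?_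
    have := le_variation u (neg_TestVF hφ)
    rw [diverg_const_smul _ hφ.1] at this
    simpa using this
  refine le_antisymm (key u) ?_
  simpa using key (fun x => - u x)

theorem variation_congr {u v : Euc N → ℝ} (h : u =ᵐ[volume] v) (Ω : Set (Euc N)) :
    variation u Ω = variation v Ω := by
  unfold variation
  refine iSup_congr fun φ => iSup_congr fun hφ => congrArg _ (integral_congr_ae (ae_restrict_of_ae ?_))
  filter_upwards [h] with x hx
  rw [hx]

theorem TestVF_smul {Ω : Set (Euc N)} {φ : Euc N → Euc N} {L : ℝ} (hL : 0 < L)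
    (h1 : ContDiff ℝ 1 φ) (h2 : HasCompactSupport φ) (h3 : tsupport φ ⊆ Ω)
    (h4 : ∀ x, ‖φ x‖ ≤ L) : L⁻¹ • φ ∈ TestVF Ω := by
  refine ⟨contDiff_const.smul h1, ?_, ?_, fun x => ?_⟩
  · exact HasCompactSupport.intro h2 fun x hx => by simp [image_eq_zero_of_notMem_tsupport hx]
  · refine subset_trans (closure_mono ?_) h3
    intro x hx hx'
    simp [hx'] at hx
  · simp only [Pi.smul_apply, norm_smul, norm_inv, Real.norm_eq_abs, abs_of_pos hL]
    rw [inv_mul_le_iff₀ hL]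
    simpa using h4 x

theorem ofReal_integral_le_mul_variation (u : Euc N → ℝ) {Ω : Set (Euc N)} {φ : Euc N → Euc N}
    {L : ℝ} (hL : 0 < L)
    (h1 : ContDiff ℝ 1 φ) (h2 : HasCompactSupport φ) (h3 : tsupport φ ⊆ Ω)
    (h4 : ∀ x, ‖φ x‖ ≤ L) :
    ENNReal.ofReal (∫ x, u x * diverg φ x) ≤ ENNReal.ofReal L * variation u Ω := by
  have := le_variation u (TestVF_smul hL h1 h2 h3 h4)
  have e : ∫ x, u x * diverg φ x = L * ∫ x, u x * diverg (L⁻¹ • φ) x := by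
    rw [diverg_const_smul _ h1, ← integral_const_mul]
    congr with x
    simp
    field_simp
  rw [e, ENNReal.ofReal_mul hL.le]
  gcongr

theorem translation_field {ψ : Euc N → ℝ} (hψ : ContDiff ℝ 1 ψ) (hψb : ∀ x, |ψ x| ≤ 1)
    (hc : HasCompactSupport ψ)
    (h : Euc N) {Ω : Set (Euc N)}
    (hΩ : ∀ z ∈ tsupport ψ, ∀ t ∈ Icc (0 : ℝ) 1, z + t • h ∈ Ω) :
    ∃ X : Euc N → Euc N, ContDiff ℝ 1 X ∧ HasCompactSupport X ∧ tsupport X ⊆ Ω ∧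
      (∀ x, ‖X x‖ ≤ ‖h‖) ∧ ∀ z, diverg X z = ψ (z - h) - ψ z := by
  have hfc : Continuous (fderiv ℝ ψ) := hψ.continuous_fderiv (by norm_num)
  have hψc : Continuous ψ := hψ.continuous
  obtain ⟨C, hC⟩ := hfc.bounded_above_of_compact_support (hc.fderiv (𝕜 := ℝ))
  set g : Euc N → ℝ := fun z => ∫ t in (0 : ℝ)..1, ψ (z - t • h) with hg
  have hderiv : ∀ z, HasFDerivAt g (∫ t in (0 : ℝ)..1, fderiv ℝ ψ (z - t • h)) z := by
    intro z
    refine intervalIntegral.hasFDerivAt_integral_of_dominated_of_fderiv_le (bound := fun _ => C)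
      (s := univ) (F := fun z t => ψ (z - t • h)) (F' := fun z t => fderiv ℝ ψ (z - t • h))
      univ_mem ?_ ?_ ?_ ?_ ?_ ?_
    · refine Eventually.of_forall fun x => Continuous.aestronglyMeasurable (by fun_prop)
    · exact Continuous.intervalIntegrable (by fun_prop) _ _
    · exact Continuous.aestronglyMeasurable (by fun_prop)
    · exact ae_of_all _ fun t _ x _ => hC _
    · exact intervalIntegrable_const
    · refine ae_of_all _ fun t _ x _ => ?_
      have h1 : HasFDerivAt ψ (fderiv ℝ ψ (x - t • h)) (x - t • h) :=
        ((hψ.differentiable (by norm_num)) _).hasFDerivAt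
      have h2 : HasFDerivAt (fun x : Euc N => x - t • h) (ContinuousLinearMap.id ℝ (Euc N)) x :=
        (hasFDerivAt_id x).sub_const _
      have h3 := HasFDerivAt.comp x (f := fun x : Euc N => x - t • h) h1 h2
      rw [ContinuousLinearMap.comp_id] at h3
      exact h3
  have hgc1 : ContDiff ℝ 1 g := by
    rw [contDiff_one_iff_fderiv]
    refine ⟨fun z => (hderiv z).differentiableAt, ?_⟩
    have : fderiv ℝ g = fun z => ∫ t in (0 : ℝ)..1, fderiv ℝ ψ (z - t • h) :=
      funext fun z => (hderiv z).fderiv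
    rw [this]
    apply intervalIntegral.continuous_parametric_intervalIntegral_of_continuous'
    fun_prop
  set K : Set (Euc N) := (fun p : ℝ × Euc N => p.2 + p.1 • h) '' (Icc (0 : ℝ) 1 ×ˢ tsupport ψ)
    with hK
  have hKc : IsCompact K := (isCompact_Icc.prod hc).image (by fun_prop)
  have hg0 : ∀ z ∉ K, g z = 0 := by
    intro z hz
    rw [hg]
    simp only
    rw [intervalIntegral.integral_congr (g := fun _ => (0 : ℝ))]
    · simp
    · intro t ht
      rw [uIcc_of_le zero_le_one] at ht
      by_contra hne
      refine hz ⟨(t, z - t • h), ⟨ht, subset_tsupport _ hne⟩, by simp⟩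
  have hgb : ∀ z, |g z| ≤ 1 := by
    intro z
    have := intervalIntegral.norm_integral_le_of_norm_le_const (a := (0 : ℝ)) (b := 1) (C := 1)
      (f := fun t => ψ (z - t • h)) (fun t _ => hψb _)
    simpa using this
  refine ⟨fun z => g z • (-h), hgc1.smul contDiff_const, ?_, ?_, ?_, ?_⟩
  · exact HasCompactSupport.intro hKc fun x hx => by simp [hg0 x hx]
  · have : tsupport (fun z => g z • (-h)) ⊆ K := by
      refine closure_minimal ?_ hKc.isClosed
      intro z hz
      by_contra hzK
      exact hz (by simp [hg0 z hzK])
    refine this.trans ?_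
    rintro _ ⟨⟨t, z⟩, ⟨ht, hz⟩, rfl⟩
    exact hΩ z hz t ht
  · intro x
    simp only [norm_smul, norm_neg, Real.norm_eq_abs]
    exact mul_le_of_le_one_left (norm_nonneg _) (hgb x)
  · intro z
    rw [diverg_smul hgc1 contDiff_const, (hderiv z).fderiv]
    have h0 : diverg (fun _ : Euc N => -h) z = 0 := by simp [diverg]
    rw [h0, mul_zero, zero_add, ContinuousLinearMap.intervalIntegral_apply]
    · have hd : ∀ t : ℝ, HasDerivAt (fun t : ℝ => ψ (z - t • h))
          (fderiv ℝ ψ (z - t • h) (-h)) t := by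
        intro t
        have h1 : HasFDerivAt ψ (fderiv ℝ ψ (z - t • h)) (z - t • h) :=
          ((hψ.differentiable (by norm_num)) _).hasFDerivAt
        have h2 : HasDerivAt (fun t : ℝ => z - t • h) (-h) t := by
          simpa using ((hasDerivAt_id t).smul_const h).const_sub z
        exact h1.comp_hasDerivAt t h2
      rw [intervalIntegral.integral_eq_sub_of_hasDerivAt (fun t _ => hd t)]
      · simp
      · exact Continuous.intervalIntegrable (by fun_prop) _ _
    · exact Continuous.intervalIntegrable (by fun_prop) _ _

theorem translation_le {u : Euc N → ℝ} (hu : Integrable u) {ψ : Euc N → ℝ}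
    (hψ : ContDiff ℝ 1 ψ) (hψb : ∀ x, |ψ x| ≤ 1) (hc : HasCompactSupport ψ)
    (h : Euc N) {Ω : Set (Euc N)} {L : ℝ} (hL : 0 < L) (hh : ‖h‖ ≤ L)
    (hΩ : ∀ z ∈ tsupport ψ, ∀ t ∈ Icc (0 : ℝ) 1, z + t • h ∈ Ω) :
    ENNReal.ofReal (∫ x, (u (x + h) - u x) * ψ x) ≤ ENNReal.ofReal L * variation u Ω := by
  obtain ⟨X, h1, h2, h3, h4, h5⟩ := translation_field hψ hψb hc h hΩ
  have := ofReal_integral_le_mul_variation u hL h1 h2 h3 (fun x => (h4 x).trans hh)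
  refine le_trans (le_of_eq ?_) this
  congr 1
  have i1 : ∀ f : Euc N → ℝ, Integrable f → Integrable (fun x => f x * ψ x) := fun f hf =>
    hf.mul_bdd (c := 1) hψ.continuous.aestronglyMeasurable (ae_of_all _ hψb)
  have i2 : Integrable (fun x => u x * ψ (x - h)) :=
    hu.mul_bdd (c := 1) (by have := hψ.continuous; exact (by fun_prop : Continuous _).aestronglyMeasurable)
      (ae_of_all _ fun x => hψb _)
  have i3 : Integrable (fun x => u (x + h)) := hu.comp_add_right h
  simp only [h5, sub_mul, mul_sub]
  rw [integral_sub (i1 _ i3) (i1 _ hu), integral_sub i2 (i1 _ hu)]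
  congr 1
  rw [← integral_add_right_eq_self (fun x => u x * ψ (x - h)) h]
  simp

theorem exists_smooth_bump {K O : Set (Euc N)} (hK : IsCompact K) (hO : IsOpen O) (hKO : K ⊆ O) :
    ∃ ψ : Euc N → ℝ, ContDiff ℝ 1 ψ ∧ HasCompactSupport ψ ∧ tsupport ψ ⊆ O ∧
      (∀ x, 0 ≤ ψ x ∧ ψ x ≤ 1) ∧ ∀ x ∈ K, ψ x = 1 := by
  obtain ⟨L, hL, hKL, hLO⟩ := exists_compact_between hK hO hKO
  obtain ⟨f, hf0, hf1, hf⟩ := exists_contMDiffMap_zero_one_of_isClosed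
    (n := (⊤ : ℕ∞)) (modelWithCornersSelf ℝ (Euc N)) (s := (interior L)ᶜ) (t := K)
    isOpen_interior.isClosed_compl hK.isClosed (by
      rw [disjoint_compl_left_iff_subset]; exact hKL)
  have hts : tsupport (f : Euc N → ℝ) ⊆ L := by
    refine closure_minimal ?_ hL.isClosed
    intro x hx
    by_contra hxL
    exact hx (hf0 (fun h => hxL (interior_subset h)))
  refine ⟨f, ?_, hL.of_isClosed_subset (isClosed_tsupport _) hts, hts.trans hLO, fun x => hf x, fun x hx => hf1 hx⟩
  exact (f.contMDiff.contDiff).of_le (by exact_mod_cast le_top)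

theorem shift_le {E : Set (Euc N)} (hE : MeasurableSet E) (hEf : volume E ≠ ⊤) (x₀ h : Euc N)
    {r : ℝ} (hr : 0 < r) (hh : ‖h‖ ≤ 2 * r) :
    volume {x | x ∈ ball x₀ r ∧ x ∉ E ∧ x + h ∈ E} ≤
      ENNReal.ofReal (2 * r) * variation (E.indicator 1) (ball x₀ (3 * r)) := by
  set u : Euc N → ℝ := E.indicator 1 with hu
  have hui : Integrable u := (integrable_indicator_iff hE).2 (integrableOn_const hEf)
  set A := {x | x ∈ ball x₀ r ∧ x ∉ E ∧ x + h ∈ E} with hA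
  have hAm : MeasurableSet A := by
    refine measurableSet_ball.inter (hE.compl.inter ?_)
    exact (measurable_add_const h) hE
  have hAf : volume A ≠ ⊤ := (measure_mono (fun x hx => hx.1)).trans_lt measure_ball_lt_top |>.ne
  refine ENNReal.le_of_forall_pos_le_add fun ε hε _ => ?_
  have hε2 : ((ε / 2 : NNReal) : ℝ≥0∞) ≠ 0 := by simpa using hε.ne'
  obtain ⟨K, hKA, hKc, hKlt⟩ := hAm.exists_isCompact_lt_add hAf hε2
  have hKf : volume K ≠ ⊤ := hKc.measure_lt_top.ne
  obtain ⟨O', hKO', hO'o, hO'lt⟩ := K.exists_isOpen_lt_add hKf hε2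
  set O := O' ∩ ball x₀ r with hO
  have hOo : IsOpen O := hO'o.inter isOpen_ball
  have hKO : K ⊆ O := subset_inter hKO' fun x hx => (hKA hx).1
  obtain ⟨ψ, p1, p2, p3, p4, p5⟩ := exists_smooth_bump hKc hOo hKO
  have hOlt : volume O ≤ volume K + (ε / 2 : NNReal) :=
    (measure_mono inter_subset_left).trans hO'lt.le
  have hOf : volume O ≠ ⊤ := ne_top_of_le_ne_top (by finiteness) hOlt
  have main := translation_le hui p1 (fun x => abs_le.2 ⟨by linarith [(p4 x).1], (p4 x).2⟩) p2 h
    (Ω := ball x₀ (3 * r)) (L := 2 * r) (by positivity) hh (by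
      intro z hz t ht
      have h1 : z ∈ ball x₀ r := (p3 hz).2
      rw [mem_ball, dist_eq_norm] at h1 ⊢
      have : z + t • h - x₀ = (z - x₀) + t • h := by abel
      rw [this]
      have h2 : ‖t • h‖ ≤ 2 * r := by
        rw [norm_smul, Real.norm_eq_abs, abs_of_nonneg ht.1]
        nlinarith [ht.2, norm_nonneg h, ht.1]
      linarith [norm_add_le (z - x₀) (t • h)])
  have hlow : volume.real K - volume.real (O \ K) ≤ ∫ x, (u (x + h) - u x) * ψ x := by
    have i1 : Integrable (K.indicator (1 : Euc N → ℝ)) :=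
      (integrable_indicator_iff hKc.measurableSet).2 (integrableOn_const hKf)
    have hm : MeasurableSet (O \ K) := hOo.measurableSet.diff hKc.measurableSet
    have i2 : Integrable ((O \ K).indicator (1 : Euc N → ℝ)) :=
      (integrable_indicator_iff hm).2
        (integrableOn_const (ne_top_of_le_ne_top hOf (measure_mono sdiff_subset)))
    have e : volume.real K - volume.real (O \ K) =
        ∫ x, (K.indicator (1 : Euc N → ℝ) x - (O \ K).indicator (1 : Euc N → ℝ) x) := by
      rw [integral_sub i1 i2, integral_indicator_one hKc.measurableSet, integral_indicator_one hm]
    rw [e]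
    refine integral_mono (i1.sub i2) ?_ ?_
    · exact ((hui.comp_add_right h).sub hui).mul_bdd (c := 1) p1.continuous.aestronglyMeasurable
        (ae_of_all _ fun x => by
          rw [Real.norm_eq_abs]; exact abs_le.2 ⟨by linarith [(p4 x).1], (p4 x).2⟩)
    · intro x
      by_cases hxK : x ∈ K
      · have h1 := hKA hxK
        have : x ∉ O \ K := fun h => h.2 hxK
        simp [hxK, p5 x hxK, hu, h1.2.1, h1.2.2]
      · by_cases hxO : x ∈ O
        · have h1 : -1 ≤ u (x + h) - u x := by
            simp only [hu, indicator]
            split_ifs <;> simp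
          have : x ∈ O \ K := ⟨hxO, hxK⟩
          simp only [hxK, this, not_false_eq_true, indicator_of_notMem, indicator_of_mem, Pi.one_apply]
          nlinarith [(p4 x).1, (p4 x).2]
        · have h1 : ψ x = 0 := image_eq_zero_of_notMem_tsupport fun h => hxO (p3 h)
          have : x ∉ O \ K := fun h => hxO h.1
          simp [hxK, this, h1]
  have hdiff : volume (O \ K) ≤ (ε / 2 : NNReal) := by
    rw [measure_sdiff hKO hKc.measurableSet.nullMeasurableSet hKf]
    exact tsub_le_iff_left.2 hOlt
  calc volume A ≤ volume K + (ε / 2 : NNReal) := hKlt.le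
    _ ≤ (ENNReal.ofReal (volume.real K - volume.real (O \ K)) + volume (O \ K)) + (ε / 2 : NNReal) := by
        gcongr
        have hOKf : volume (O \ K) ≠ ⊤ := ne_top_of_le_ne_top hOf (measure_mono sdiff_subset)
        calc volume K = ENNReal.ofReal (volume K).toReal := (ENNReal.ofReal_toReal hKf).symm
          _ = ENNReal.ofReal ((volume.real K - volume.real (O \ K)) + (volume (O \ K)).toReal) := by
            simp [Measure.real]
          _ ≤ _ := ENNReal.ofReal_add_le
          _ = _ := by rw [ENNReal.ofReal_toReal hOKf]
    _ ≤ (ENNReal.ofReal (∫ x, (u (x + h) - u x) * ψ x) + (ε / 2 : NNReal)) + (ε / 2 : NNReal) := by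
        gcongr
    _ ≤ (ENNReal.ofReal (2 * r) * variation u (ball x₀ (3 * r)) + (ε / 2 : NNReal)) + (ε / 2 : NNReal) := by
        gcongr
    _ = _ := by
        rw [add_assoc, ← ENNReal.coe_add, add_halves]

theorem rel_isoperimetric {E : Set (Euc N)} (hE : MeasurableSet E) (hEf : volume E ≠ ⊤)
    (x₀ : Euc N) {r : ℝ} (hr : 0 < r) :
    volume (E ∩ ball x₀ r) * volume (ball x₀ r \ E) ≤
      ENNReal.ofReal (2 * r) * variation (E.indicator 1) (ball x₀ (3 * r)) *
        volume (ball x₀ (2 * r)) := by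
  set B := ball x₀ r
  set S : Set (Euc N × Euc N) := {p | p.1 ∈ B \ E ∧ p.1 + p.2 ∈ E ∩ B} with hS
  have hSm : MeasurableSet S := by
    refine MeasurableSet.inter ?_ ?_
    · exact measurable_fst (measurableSet_ball.diff hE)
    · exact (measurable_fst.add measurable_snd) (hE.inter measurableSet_ball)
  have e1 : (volume.prod volume) S = volume (E ∩ B) * volume (B \ E) := by
    rw [Measure.prod_apply hSm]
    have : ∀ x : Euc N, volume (Prod.mk x ⁻¹' S) =
        (B \ E).indicator (fun _ => volume (E ∩ B)) x := by
      intro x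
      by_cases hx : x ∈ B \ E
      · rw [indicator_of_mem hx]
        have : Prod.mk x ⁻¹' S = (fun h => x + h) ⁻¹' (E ∩ B) := by
          ext h
          simp only [hS, mem_preimage, mem_ofPred_eq]
          exact ⟨fun h => h.2, fun h => ⟨hx, h⟩⟩
        rw [this, measure_preimage_add]
      · rw [indicator_of_notMem hx]
        have : Prod.mk x ⁻¹' S = ∅ := by
          ext h
          simp only [hS, mem_preimage, mem_ofPred_eq, mem_empty_iff_false, iff_false]
          exact fun h => hx h.1
        rw [this, measure_empty]
    simp_rw [this]
    rw [lintegral_indicator_const (measurableSet_ball.diff hE)]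
  rw [← e1, Measure.prod_apply_symm hSm]
  calc ∫⁻ h, volume ((fun x => (x, h)) ⁻¹' S)
      ≤ ∫⁻ h, (ball (0 : Euc N) (2 * r)).indicator (fun _ =>
          ENNReal.ofReal (2 * r) * variation (E.indicator 1) (ball x₀ (3 * r))) h := by
        refine lintegral_mono fun h => ?_
        by_cases hh : h ∈ ball (0 : Euc N) (2 * r)
        · rw [indicator_of_mem hh]
          refine le_trans (measure_mono ?_)
            (shift_le hE hEf x₀ h hr (mem_ball_zero_iff.1 hh).le)
          intro x hx
          exact ⟨hx.1.1, hx.1.2, hx.2.1⟩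
        · rw [indicator_of_notMem hh]
          refine le_of_eq ?_
          have : (fun x => (x, h)) ⁻¹' S = ∅ := by
            ext x
            simp only [hS, mem_preimage, mem_ofPred_eq, mem_empty_iff_false, iff_false]
            rintro ⟨⟨h1, _⟩, _, h2⟩
            apply hh
            rw [mem_ball_zero_iff]
            have h3 := dist_triangle_right (x + h) x x₀
            have h4 : dist (x + h) x = ‖h‖ := by simp [dist_eq_norm]
            rw [mem_ball] at h1 h2
            linarith
          rw [this, measure_empty]
    _ = _ := by
        rw [lintegral_indicator_const measurableSet_ball, Measure.addHaar_ball_center]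
        congr 1
        exact (Measure.addHaar_ball_center _ _ _).symm

open scoped Convolution in
/-- mollification -/
def moll (b : ContDiffBump (0 : Euc N)) (w : Euc N → ℝ) : Euc N → ℝ :=
  (b.normed volume) ⋆[ContinuousLinearMap.lsmul ℝ ℝ, volume] w

theorem moll_apply (b : ContDiffBump (0 : Euc N)) (w : Euc N → ℝ) (x : Euc N) :
    moll b w x = ∫ z, b.normed volume (x - z) * w z := by
  rw [moll, convolution_eq_swap]
  simp

theorem moll_contDiff (b : ContDiffBump (0 : Euc N)) {w : Euc N → ℝ} (hw : Integrable w) :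
    ContDiff ℝ 1 (moll b w) := by
  have h := b.contDiff_normed (μ := (volume : Measure (Euc N))) (n := 1)
  exact b.hasCompactSupport_normed.contDiff_convolution_left (n := 1) _ (by exact_mod_cast h) hw.locallyIntegrable

open scoped Convolution Pointwise in
theorem moll_pair (b : ContDiffBump (0 : Euc N)) {w : Euc N → ℝ} (hw : Integrable w)
    {X : Euc N → Euc N} (hX : ContDiff ℝ 1 X) (hc : HasCompactSupport X) {L : ℝ}
    (hL : ∀ x, ‖X x‖ ≤ L) :
    ∃ Y : Euc N → Euc N, ContDiff ℝ 1 Y ∧ HasCompactSupport Y ∧ (∀ x, ‖Y x‖ ≤ L) ∧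
      (∀ y ∈ tsupport Y, ∃ x ∈ tsupport X, dist y x ≤ b.rOut) ∧
      ∫ x, moll b w x * diverg X x = ∫ x, w x * diverg Y x := by
  set ρ := b.normed (volume : Measure (Euc N)) with hρ
  have hρc : Continuous ρ := b.continuous_normed
  have hρs : HasCompactSupport ρ := b.hasCompactSupport_normed
  have hρi : Integrable ρ := b.integrable_normed
  set Y : Euc N → Euc N := ρ ⋆[ContinuousLinearMap.lsmul ℝ ℝ, volume] X with hY
  have hXc : Continuous X := hX.continuous
  have hdX : Continuous (fderiv ℝ X) := hX.continuous_fderiv (by norm_num)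
  have hdiv : ∀ x, diverg Y x = ∫ z, ρ (x - z) * diverg X z := by
    intro x
    have h1 := hc.hasFDerivAt_convolution_right (ContinuousLinearMap.lsmul ℝ ℝ)
      (μ := (volume : Measure (Euc N))) hρi.locallyIntegrable hX x
    have e : ∀ i : Fin N, (fderiv ℝ Y x (EuclideanSpace.single i 1)) i =
        ∫ t, ρ t * (fderiv ℝ X (x - t) (EuclideanSpace.single i 1)) i := by
      intro i
      rw [h1.fderiv, convolution_precompR_apply _ hρi.locallyIntegrable (hc.fderiv (𝕜 := ℝ)) hdX]
      rw [convolution_def]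
      have hInteg : Integrable (fun t => (ContinuousLinearMap.lsmul ℝ ℝ (ρ t))
          (fderiv ℝ X (x - t) (EuclideanSpace.single i 1))) := by
        apply Continuous.integrable_of_hasCompactSupport
        · simp only [ContinuousLinearMap.lsmul_apply]
          fun_prop
        · refine HasCompactSupport.intro hρs fun t ht => ?_
          simp [image_eq_zero_of_notMem_tsupport ht]
      have := (EuclideanSpace.proj i : Euc N →L[ℝ] ℝ).integral_comp_comm hInteg
      simpa using this.symm
    rw [diverg]
    simp only [e]
    rw [← integral_finsetSum]
    · have h2 : ∀ t, ∑ i : Fin N, ρ t * (fderiv ℝ X (x - t) (EuclideanSpace.single i 1)) i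
          = ρ t * diverg X (x - t) := fun t => by rw [diverg, Finset.mul_sum]
      simp only [h2]
      rw [← integral_sub_left_eq_self (fun z => ρ (x - z) * diverg X z) volume x]
      simp
    · intro i _
      apply Continuous.integrable_of_hasCompactSupport
      · fun_prop
      · refine HasCompactSupport.intro hρs fun t ht => ?_
        simp [image_eq_zero_of_notMem_tsupport ht]
  have hcompact : IsCompact (closedBall (0 : Euc N) b.rOut + tsupport X) :=
    (isCompact_closedBall _ _).add hc
  have hts : tsupport Y ⊆ closedBall (0 : Euc N) b.rOut + tsupport X := by
    refine closure_minimal ?_ hcompact.isClosed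
    refine (support_convolution_subset _).trans (Set.add_subset_add ?_ (subset_tsupport _))
    rw [hρ, b.support_normed_eq]
    exact ball_subset_closedBall
  refine ⟨Y, ?_, hcompact.of_isClosed_subset (isClosed_tsupport _) hts, ?_, ?_, ?_⟩
  · exact hc.contDiff_convolution_right (n := 1) _ hρi.locallyIntegrable hX
  · intro x
    rw [hY, convolution_def]
    calc ‖∫ t, (ContinuousLinearMap.lsmul ℝ ℝ (ρ t)) (X (x - t))‖ ≤ ∫ t, ρ t * L := by
          refine norm_integral_le_of_norm_le (hρi.mul_const L) (ae_of_all _ fun t => ?_)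
          simp only [ContinuousLinearMap.lsmul_apply, norm_smul, Real.norm_eq_abs,
            abs_of_nonneg (b.nonneg_normed t), hρ]
          exact mul_le_mul_of_nonneg_left (hL _) (b.nonneg_normed t)
      _ = L := by rw [integral_mul_const, hρ, b.integral_normed, one_mul]
  · intro y hy
    obtain ⟨a, ha, x, hx, rfl⟩ := Set.mem_add.1 (hts hy)
    refine ⟨x, hx, ?_⟩
    simpa [dist_eq_norm] using ha
  · simp only [hdiv, moll_apply, ← hρ]
    have hD : Continuous (diverg X) := diverg_continuous hX
    have hDi : Integrable (diverg X) := hD.integrable_of_hasCompactSupport (diverg_compact hc)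
    obtain ⟨C, hC⟩ := hρc.bounded_above_of_compact_support hρs
    have hInteg : Integrable (fun p : Euc N × Euc N => (w p.1 * diverg X p.2) * ρ (p.1 - p.2))
        (volume.prod volume) :=
      (hw.mul_prod hDi).mul_bdd (c := C)
        (by exact (by fun_prop : Continuous _).aestronglyMeasurable) (ae_of_all _ fun p => hC _)
    have hswap := integral_integral_swap (f := fun x z => (w x * diverg X z) * ρ (x - z)) hInteg
    calc ∫ z, (∫ x, ρ (z - x) * w x) * diverg X z
        = ∫ z, ∫ x, (w x * diverg X z) * ρ (x - z) := by
          congr with z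
          rw [← integral_mul_const]
          congr with x
          have : ρ (z - x) = ρ (x - z) := by rw [hρ, ← b.normed_neg, neg_sub]
          rw [this]; ring
      _ = ∫ x, ∫ z, (w x * diverg X z) * ρ (x - z) := hswap.symm
      _ = _ := by
          congr with x
          rw [← integral_const_mul]
          congr with z
          ring

theorem diverg_sum {ι : Type*} (s : Finset ι) (X : ι → Euc N → Euc N)
    (h : ∀ i ∈ s, ContDiff ℝ 1 (X i)) (x : Euc N) :
    diverg (fun x => ∑ i ∈ s, X i x) x = ∑ i ∈ s, diverg (X i) x := by
  simp only [diverg]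
  rw [fderiv_fun_sum (fun i hi => (h i hi).differentiable (by norm_num) x)]
  simp only [sum_apply, WithLp.ofLp_sum, Finset.sum_apply]
  rw [Finset.sum_comm]

theorem chain_ibp {f : Euc N → ℝ} (hf : ContDiff ℝ 1 f) {φ : ℝ → ℝ} (hφ : ContDiff ℝ 2 φ)
    {ψ : Euc N → Euc N} (hψ : ContDiff ℝ 1 ψ) (hc : HasCompactSupport ψ) :
    ∫ x, φ (f x) * diverg ψ x = ∫ x, f x * diverg (fun x => deriv φ (f x) • ψ x) x := by
  have hφ' : ContDiff ℝ 1 (deriv φ) := by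
    have : ContDiff ℝ (1 + 1) φ := by simpa [one_add_one_eq_two] using hφ
    exact (contDiff_succ_iff_deriv.1 this).2.2
  have hφ1 : ContDiff ℝ 1 φ := hφ.of_le (by norm_num)
  have hφf : ContDiff ℝ 1 (fun x => φ (f x)) := hφ1.comp hf
  have hX : ContDiff ℝ 1 (fun x => deriv φ (f x) • ψ x) := (hφ'.comp hf).smul hψ
  have hXc : HasCompactSupport (fun x => deriv φ (f x) • ψ x) :=
    HasCompactSupport.intro hc fun x hx => by simp [image_eq_zero_of_notMem_tsupport hx]
  have e1 := integral_diverg (φ := fun x => φ (f x) • ψ x) (hφf.smul hψ)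
    (HasCompactSupport.intro hc fun x hx => by simp [image_eq_zero_of_notMem_tsupport hx])
  have e2 := integral_diverg (φ := fun x => f x • (deriv φ (f x) • ψ x)) (hf.smul hX)
    (HasCompactSupport.intro hc fun x hx => by simp [image_eq_zero_of_notMem_tsupport hx])
  simp only [diverg_smul hφf hψ] at e1
  simp only [diverg_smul hf hX] at e2
  have hfd : ∀ x v, fderiv ℝ (fun x => φ (f x)) x v = fderiv ℝ f x (deriv φ (f x) • v) := by
    intro x v
    have h1 := (hφ1.differentiable (by norm_num) (f x)).hasDerivAt
    have h2 := (hf.differentiable (by norm_num) x).hasFDerivAt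
    have h3 : HasFDerivAt (fun x => φ (f x)) (deriv φ (f x) • fderiv ℝ f x) x := h1.comp_hasFDerivAt x h2
    rw [h3.fderiv]
    simp
  simp only [hfd] at e1
  have c1 := diverg_continuous hψ
  have c2 := diverg_continuous hX
  have c3 := hf.continuous
  have c4 := hf.continuous_fderiv (by norm_num)
  have c5 := hψ.continuous
  have c6 := hφ'.continuous
  have c7 := hφ.continuous
  have i1 : Integrable (fun x => φ (f x) * diverg ψ x) := by
    apply Continuous.integrable_of_hasCompactSupport (by fun_prop)
    exact HasCompactSupport.intro hc fun x hx => by simp [diverg_zero_off hx]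
  have i2 : Integrable (fun x => f x * diverg (fun x => deriv φ (f x) • ψ x) x) := by
    apply Continuous.integrable_of_hasCompactSupport (by fun_prop)
    exact HasCompactSupport.intro hXc fun x hx => by simp [diverg_zero_off hx]
  have i3 : Integrable (fun x => fderiv ℝ f x (deriv φ (f x) • ψ x)) := by
    apply Continuous.integrable_of_hasCompactSupport (by fun_prop)
    exact HasCompactSupport.intro hc fun x hx => by simp [image_eq_zero_of_notMem_tsupport hx]
  rw [integral_add i1 i3] at e1
  rw [integral_add i2 i3] at e2
  linarith

/-- the sequence of mollifiers -/
def bmp (N : ℕ) (n : ℕ) : ContDiffBump (0 : Euc N) where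
  rIn := 1 / (2 * ((n : ℝ) + 1))
  rOut := 1 / ((n : ℝ) + 1)
  rIn_pos := by positivity
  rIn_lt_rOut := by
    apply one_div_lt_one_div_of_lt <;> nlinarith [(Nat.cast_nonneg n : (0 : ℝ) ≤ n)]

theorem bmp_rOut (n : ℕ) : (bmp N n).rOut = 1 / ((n : ℝ) + 1) := rfl
theorem bmp_rIn (n : ℕ) : (bmp N n).rIn = 1 / (2 * ((n : ℝ) + 1)) := rfl

theorem moll_tendsto {w : Euc N → ℝ} (hw : Integrable w) :
    ∀ᵐ x, Tendsto (fun n => moll (bmp N n) w x) atTop (𝓝 (w x)) := by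
  refine ContDiffBump.ae_convolution_tendsto_right_of_locallyIntegrable (K := 2) ?_ ?_
    hw.locallyIntegrable
  · simp only [bmp_rOut]
    exact tendsto_one_div_add_atTop_nhds_zero_nat
  · refine Eventually.of_forall fun n => ?_
    rw [bmp_rOut, bmp_rIn]
    apply le_of_eq
    field_simp

theorem chain_main {w : Euc N → ℝ} (hw : Integrable w) {ι : Type*} (s : Finset ι)
    (φ : ι → ℝ → ℝ) (hφ : ∀ i, ContDiff ℝ 2 (φ i)) (M : ℝ) (hM : ∀ i τ, |φ i τ| ≤ M)
    {L : ℝ} (hL : 0 < L) (hφL : ∀ τ, ∑ i ∈ s, |deriv (φ i) τ| ≤ L)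
    (ψ : ι → Euc N → Euc N) (h1 : ∀ i, ContDiff ℝ 1 (ψ i)) (h2 : ∀ i, HasCompactSupport (ψ i))
    (h3 : ∀ i x, ‖ψ i x‖ ≤ 1) (Ω : Set (Euc N))
    (hΩ : ∀ᶠ n in atTop, ∀ x ∈ tsupport (fun x => ∑ i ∈ s, deriv (φ i) (moll (bmp N n) w x) • ψ i x),
      closedBall x (1 / ((n : ℝ) + 1)) ⊆ Ω) :
    ENNReal.ofReal (∑ i ∈ s, ∫ x, φ i (w x) * diverg (ψ i) x) ≤ ENNReal.ofReal L * variation w Ω := by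
  have hφ' : ∀ i, ContDiff ℝ 1 (deriv (φ i)) := fun i => by
    have : ContDiff ℝ (1 + 1) (φ i) := by simpa [one_add_one_eq_two] using hφ i
    exact (contDiff_succ_iff_deriv.1 this).2.2
  have hlim : Tendsto (fun n => ∑ i ∈ s, ∫ x, φ i (moll (bmp N n) w x) * diverg (ψ i) x) atTop
      (𝓝 (∑ i ∈ s, ∫ x, φ i (w x) * diverg (ψ i) x)) := by
    refine tendsto_finsetSum s fun i _ => ?_
    have hD := diverg_continuous (h1 i)
    refine tendsto_integral_of_dominated_convergence (fun x => M * ‖diverg (ψ i) x‖) ?_ ?_ ?_ ?_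
    · intro n
      have := (moll_contDiff (bmp N n) hw).continuous
      have := (hφ i).continuous
      exact (by fun_prop : Continuous _).aestronglyMeasurable
    · exact ((hD.integrable_of_hasCompactSupport (diverg_compact (h2 i))).norm.const_mul M)
    · intro n
      refine ae_of_all _ fun x => ?_
      rw [norm_mul]
      exact mul_le_mul_of_nonneg_right (hM _ _) (norm_nonneg _)
    · filter_upwards [moll_tendsto hw] with x hx
      exact (((hφ i).continuous.tendsto _).comp hx).mul_const _
  refine le_of_tendsto ((ENNReal.continuous_ofReal.tendsto _).comp hlim) ?_
  filter_upwards [hΩ] with n hn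
  simp only [Function.comp]
  have hf := moll_contDiff (bmp N n) hw
  set f := moll (bmp N n) w with hfdef
  have hXi : ∀ i, ContDiff ℝ 1 (fun x => deriv (φ i) (f x) • ψ i x) := fun i =>
    ((hφ' i).comp hf).smul (h1 i)
  have hXc : ∀ i, HasCompactSupport (fun x => deriv (φ i) (f x) • ψ i x) := fun i =>
    HasCompactSupport.intro (h2 i) fun x hx => by simp [image_eq_zero_of_notMem_tsupport hx]
  have e : ∑ i ∈ s, ∫ x, φ i (f x) * diverg (ψ i) x =
      ∫ x, f x * diverg (fun x => ∑ i ∈ s, deriv (φ i) (f x) • ψ i x) x := by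
    simp only [diverg_sum s _ (fun i _ => hXi i), Finset.mul_sum]
    rw [integral_finsetSum]
    · exact Finset.sum_congr rfl fun i _ => chain_ibp hf (hφ i) (h1 i) (h2 i)
    · intro i _
      have c2 := diverg_continuous (hXi i)
      have c3 := hf.continuous
      apply Continuous.integrable_of_hasCompactSupport (by fun_prop)
      exact HasCompactSupport.intro (hXc i) fun x hx => by simp [diverg_zero_off hx]
  rw [e]
  have hX : ContDiff ℝ 1 (fun x => ∑ i ∈ s, deriv (φ i) (f x) • ψ i x) :=
    ContDiff.sum fun i _ => hXi i
  have hXs : HasCompactSupport (fun x => ∑ i ∈ s, deriv (φ i) (f x) • ψ i x) := by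
    refine HasCompactSupport.intro (s.isCompact_biUnion fun i _ => h2 i) fun x hx => ?_
    refine Finset.sum_eq_zero fun i hi => ?_
    have : x ∉ tsupport (ψ i) := fun h => hx (mem_biUnion hi h)
    simp [image_eq_zero_of_notMem_tsupport this]
  have hXL : ∀ x, ‖∑ i ∈ s, deriv (φ i) (f x) • ψ i x‖ ≤ L := by
    intro x
    refine (norm_sum_le _ _).trans (le_trans (Finset.sum_le_sum fun i _ => ?_) (hφL (f x)))
    rw [norm_smul, Real.norm_eq_abs]
    exact mul_le_of_le_one_right (abs_nonneg _) (h3 i x)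
  obtain ⟨Y, y1, y2, y3, y4, y5⟩ := moll_pair (bmp N n) hw hX hXs hXL
  rw [y5]
  refine ofReal_integral_le_mul_variation w hL y1 y2 ?_ y3
  intro y hy
  obtain ⟨x, hx, hxy⟩ := y4 y hy
  exact hn x hx hxy

theorem st_deriv_exists : ∃ C : ℝ, 0 < C ∧ ∀ y, |deriv Real.smoothTransition y| ≤ C := by
  have hc : Continuous (deriv Real.smoothTransition) :=
    (Real.smoothTransition.contDiff (n := 1)).continuous_deriv (by norm_num)
  obtain ⟨C, hC⟩ := (isCompact_Icc (a := (0 : ℝ)) (b := 1)).exists_bound_of_continuousOn hc.continuousOn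
  refine ⟨max C 1, by positivity, fun y => ?_⟩
  by_cases hy : y ∈ Icc (0 : ℝ) 1
  · exact (hC y hy).trans (le_max_left _ _)
  · have : deriv Real.smoothTransition y = 0 := by
      rw [mem_Icc, not_and_or, not_le, not_le] at hy
      rcases hy with hy | hy
      · apply IsLocalMin.deriv_eq_zero
        refine Eventually.of_forall fun z => ?_
        rw [Real.smoothTransition.zero_of_nonpos hy.le]
        exact Real.smoothTransition.nonneg z
      · apply IsLocalMax.deriv_eq_zero
        refine Eventually.of_forall fun z => ?_
        rw [Real.smoothTransition.one_of_one_le hy.le]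
        exact Real.smoothTransition.le_one z
    rw [this]; simp

theorem st_deriv_zero {y : ℝ} (hy : y ≤ 0 ∨ 1 ≤ y) : deriv Real.smoothTransition y = 0 := by
  rcases hy with hy | hy
  · apply IsLocalMin.deriv_eq_zero
    refine Eventually.of_forall fun z => ?_
    rw [Real.smoothTransition.zero_of_nonpos hy]
    exact Real.smoothTransition.nonneg z
  · apply IsLocalMax.deriv_eq_zero
    refine Eventually.of_forall fun z => ?_
    rw [Real.smoothTransition.one_of_one_le hy]
    exact Real.smoothTransition.le_one z

/-- a bound for the derivative of the smooth transition -/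
def stC : ℝ := st_deriv_exists.choose
theorem stC_pos : 0 < stC := st_deriv_exists.choose_spec.1
theorem stC_bound (y : ℝ) : |deriv Real.smoothTransition y| ≤ stC := st_deriv_exists.choose_spec.2 y

theorem cover_half {a t : ℝ} (hat : a ≤ t) (h : ℝ → ℝ) (hpos : ∀ s, 0 < h s) :
    ∃ F : Finset ℝ, (∀ s ∈ F, s ∈ Icc a t) ∧ (∀ s ∈ F, ∀ s' ∈ F, s < s' → s + h s ≤ s') ∧
      (t - a) / 2 ≤ ∑ s ∈ F, h s := by
  classical
  set S : Set ℝ := {b | b ∈ Icc a t ∧ ∃ F : Finset ℝ, (∀ s ∈ F, s ∈ Icc a t) ∧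
    (∀ s ∈ F, ∀ s' ∈ F, s < s' → s + h s ≤ s') ∧ (∀ s ∈ F, s + h s ≤ b) ∧
      (b - a) / 2 ≤ ∑ s ∈ F, h s} with hS
  have haS : a ∈ S := ⟨⟨le_rfl, hat⟩, ∅, by simp, by simp, by simp, by simp⟩
  have hbdd : BddAbove S := ⟨t, fun b hb => hb.1.2⟩
  set B := sSup S with hB
  have hBmem : B ∈ Icc a t := ⟨le_csSup hbdd haS, csSup_le ⟨a, haS⟩ fun b hb => hb.1.2⟩
  obtain ⟨b, hbS, hb⟩ := exists_lt_of_lt_csSup ⟨a, haS⟩ (show B - h B < sSup S by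
    have := hpos B; linarith)
  have hbB : b ≤ B := le_csSup hbdd hbS
  obtain ⟨hb1, F, f1, f2, f3, f4⟩ := hbS
  have hBF : B ∉ F := fun hBF => by
    have := f3 B hBF; have := hpos B; linarith
  have g1 : ∀ s ∈ insert B F, s ∈ Icc a t := by
    intro s hs
    rcases Finset.mem_insert.1 hs with rfl | hs
    · exact hBmem
    · exact f1 s hs
  have g2 : ∀ s ∈ insert B F, ∀ s' ∈ insert B F, s < s' → s + h s ≤ s' := by
    intro s hs s' hs' hlt
    rcases Finset.mem_insert.1 hs with hs | hs
    · rcases Finset.mem_insert.1 hs' with hs' | hs'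
      · linarith
      · have := f3 s' hs'; have := hpos s'; linarith
    · rcases Finset.mem_insert.1 hs' with hs' | hs'
      · have := f3 s hs; linarith
      · exact f2 s hs s' hs' hlt
  have g4 : (B + h B - a) / 2 ≤ ∑ s ∈ insert B F, h s := by
    rw [Finset.sum_insert hBF]; linarith
  by_cases hle : B + h B ≤ t
  · exfalso
    have : B + h B ∈ S := by
      refine ⟨⟨?_, hle⟩, insert B F, g1, g2, ?_, g4⟩
      · have := hpos B; linarith [hBmem.1]
      · intro s hs
        rcases Finset.mem_insert.1 hs with rfl | hs
        · exact le_rfl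
        · have := f3 s hs; have := hpos B; linarith
    have := le_csSup hbdd this
    have := hpos B
    linarith
  · exact ⟨insert B F, g1, g2, by linarith⟩

theorem level_approx {w : Euc N → ℝ} (hw : Integrable w) (s : ℝ) {ψ : Euc N → Euc N}
    (hψ : ψ ∈ TestVF (univ : Set (Euc N))) :
    Tendsto (fun n : ℕ => ∫ x, Real.smoothTransition ((w x - s) / (1 / ((n : ℝ) + 1))) * diverg ψ x)
      atTop (𝓝 (∫ x, ({x | s < w x}.indicator 1 x : ℝ) * diverg ψ x)) := by
  have hD := diverg_continuous hψ.1
  refine tendsto_integral_of_dominated_convergence (fun x => ‖diverg ψ x‖) ?_ ?_ ?_ ?_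
  · intro n
    refine AEStronglyMeasurable.mul ?_ hD.aestronglyMeasurable
    have : Continuous fun τ : ℝ => Real.smoothTransition ((τ - s) / (1 / ((n : ℝ) + 1))) :=
      Real.smoothTransition.continuous.comp (by fun_prop)
    exact this.comp_aestronglyMeasurable hw.1
  · exact (hD.integrable_of_hasCompactSupport (diverg_compact hψ.2.1)).norm
  · intro n
    refine ae_of_all _ fun x => ?_
    rw [norm_mul]
    refine mul_le_of_le_one_left (norm_nonneg _) ?_
    rw [Real.norm_eq_abs, abs_of_nonneg (Real.smoothTransition.nonneg _)]
    exact Real.smoothTransition.le_one _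
  · refine ae_of_all _ fun x => Tendsto.mul_const _ ?_
    by_cases hx : s < w x
    · have e : ({x | s < w x}.indicator 1 x : ℝ) = 1 := by
        rw [indicator_of_mem (show x ∈ {x | s < w x} from hx)]; rfl
      rw [e]
      refine tendsto_const_nhds.congr' ?_
      obtain ⟨n₀, hn₀⟩ := exists_nat_gt (1 / (w x - s))
      filter_upwards [eventually_ge_atTop n₀] with n hn
      have hn' : (n₀ : ℝ) ≤ n := by exact_mod_cast hn
      rw [Real.smoothTransition.one_of_one_le]
      have h0 : 0 < w x - s := by linarith
      rw [div_div_eq_mul_div, div_one]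
      rw [div_lt_iff₀ h0] at hn₀
      nlinarith
    · have e : ({x | s < w x}.indicator 1 x : ℝ) = 0 := 
        indicator_of_notMem (show x ∉ {x | s < w x} from hx) _
      rw [e]
      refine tendsto_const_nhds.congr fun n => ?_
      rw [Real.smoothTransition.zero_of_nonpos]
      exact div_nonpos_of_nonpos_of_nonneg (by linarith) (by positivity)

theorem coarea_aux {w : Euc N → ℝ} (hw : Integrable w) {a t c : ℝ} (hat : a ≤ t) (hc : 0 ≤ c)
    (hs : ∀ s ∈ Icc a t, ENNReal.ofReal c < variation ({x | s < w x}.indicator 1) univ) :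
    ENNReal.ofReal (c * (t - a) / (2 * stC)) ≤ variation w univ := by
  have hC := stC_pos
  have key : ∀ s : ℝ, ∃ h : ℝ, ∃ ψ ∈ TestVF (univ : Set (Euc N)), 0 < h ∧ h ≤ 1 ∧
      (s ∈ Icc a t → c < ∫ x, Real.smoothTransition ((w x - s) / h) * diverg ψ x) := by
    intro s
    by_cases hst : s ∈ Icc a t
    · have h1 := hs s hst
      rw [variation] at h1
      obtain ⟨ψ, hψ⟩ := lt_iSup_iff.1 h1
      obtain ⟨hψT, hψ⟩ := lt_iSup_iff.1 hψ
      rw [setIntegral_testVF _ hψT] at hψ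
      have h2 := (ENNReal.ofReal_lt_ofReal_iff_of_nonneg hc).1 hψ
      obtain ⟨n, hn⟩ := ((level_approx hw s hψT).eventually (lt_mem_nhds h2)).exists
      refine ⟨1 / ((n : ℝ) + 1), ψ, hψT, by positivity, ?_, fun _ => hn⟩
      rw [div_le_one (by positivity)]
      linarith [(Nat.cast_nonneg n : (0 : ℝ) ≤ n)]
    · exact ⟨1, 0, zero_TestVF _, one_pos, le_rfl, fun h => absurd h hst⟩
  choose h ψ hψ hpos hle hInteg using key
  obtain ⟨F, f1, f2, f3⟩ := cover_half hat h hpos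
  set φ : ℝ → ℝ → ℝ := fun s τ => h s / stC * Real.smoothTransition ((τ - s) / h s) with hφdef
  have hφc : ∀ s, ContDiff ℝ 2 (φ s) := fun s =>
    contDiff_const.mul (Real.smoothTransition.contDiff.comp (by fun_prop))
  have hφM : ∀ s τ, |φ s τ| ≤ 1 / stC := by
    intro s τ
    rw [hφdef]
    simp only
    rw [abs_of_nonneg (mul_nonneg (div_nonneg (hpos s).le hC.le) (Real.smoothTransition.nonneg _))]
    calc h s / stC * Real.smoothTransition ((τ - s) / h s) ≤ h s / stC :=
          mul_le_of_le_one_right (div_nonneg (hpos s).le hC.le) (Real.smoothTransition.le_one _)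
      _ ≤ 1 / stC := by gcongr; exact hle s
  have hder : ∀ s τ, deriv (φ s) τ = 1 / stC * deriv Real.smoothTransition ((τ - s) / h s) := by
    intro s τ
    have h1 : HasDerivAt Real.smoothTransition (deriv Real.smoothTransition ((τ - s) / h s))
        ((τ - s) / h s) :=
      ((Real.smoothTransition.contDiff (n := 1)).differentiable (by norm_num) _).hasDerivAt
    have h2 : HasDerivAt (fun τ : ℝ => (τ - s) / h s) (1 / h s) τ :=
      ((hasDerivAt_id τ).sub_const s).div_const (h s)
    have h3 := (h1.comp τ h2).const_mul (h s / stC)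
    have h4 : HasDerivAt (φ s) _ τ := h3
    rw [h4.deriv]
    have := (hpos s).ne'
    field_simp
  have hsum : ∀ τ, ∑ s ∈ F, |deriv (φ s) τ| ≤ 1 := by
    intro τ
    have hone : ∀ s, |deriv (φ s) τ| ≤ 1 := by
      intro s
      rw [hder, abs_mul, abs_of_pos (by positivity)]
      rw [one_div, inv_mul_le_iff₀ hC, mul_one]
      exact stC_bound _
    have hz : ∀ s, deriv (φ s) τ ≠ 0 → s < τ ∧ τ < s + h s := by
      intro s hne
      rw [hder] at hne
      by_contra hcon
      apply hne
      rw [st_deriv_zero, mul_zero]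
      rw [not_and_or, not_lt, not_lt] at hcon
      rcases hcon with hcon | hcon
      · left; exact div_nonpos_of_nonpos_of_nonneg (by linarith) (hpos s).le
      · right; rw [le_div_iff₀ (hpos s)]; linarith
    by_cases hex : ∃ s ∈ F, deriv (φ s) τ ≠ 0
    · obtain ⟨s, hsF, hsne⟩ := hex
      rw [Finset.sum_eq_single_of_mem s hsF]
      · exact hone s
      · intro s' hs'F hne
        by_contra hcon
        have h1 := hz s hsne
        have h2 := hz s' (fun h0 => hcon (by rw [h0, abs_zero]))
        rcases lt_or_gt_of_ne hne with hlt | hlt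
        · have := f2 s' hs'F s hsF hlt; linarith
        · have := f2 s hsF s' hs'F hlt; linarith
    · push Not at hex
      rw [Finset.sum_eq_zero fun s hs => by rw [hex s hs, abs_zero]]
      exact zero_le_one
  have main := chain_main hw F φ hφc (1 / stC) hφM one_pos hsum ψ (fun s => (hψ s).1)
    (fun s => (hψ s).2.1) (fun s => (hψ s).2.2.2) univ (Eventually.of_forall fun n x _ => subset_univ _)
  rw [ENNReal.ofReal_one, one_mul] at main
  refine le_trans (ENNReal.ofReal_le_ofReal ?_) main
  calc c * (t - a) / (2 * stC) = (t - a) / 2 * (c / stC) := by field_simp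
    _ ≤ (∑ s ∈ F, h s) * (c / stC) := by gcongr
    _ = ∑ s ∈ F, h s / stC * c := by rw [Finset.sum_mul]; congr with s; ring
    _ ≤ _ := by
        refine Finset.sum_le_sum fun s hsF => ?_
        have e : ∀ x, φ s (w x) * diverg (ψ s) x =
          h s / stC * (Real.smoothTransition ((w x - s) / h s) * diverg (ψ s) x) := fun x => by
            simp only [hφdef]; ring
        simp only [e]
        rw [integral_const_mul]
        exact mul_le_mul_of_nonneg_left (hInteg s (f1 s hsF)).le (div_nonneg (hpos s).le hC.le)

theorem coarea_level {w : Euc N → ℝ} (hw : Integrable w) {t κ : ℝ} (ht : 0 < t) (hκ : 0 < κ)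
    (hV : variation w univ ≤ ENNReal.ofReal κ) :
    ∃ s ∈ Icc (t / 2) t, variation ({x | s < w x}.indicator 1) univ
      ≤ ENNReal.ofReal (8 * stC * κ / t) := by
  have hC := stC_pos
  by_contra! hcon
  have h := coarea_aux hw (by linarith : t / 2 ≤ t) (by positivity) hcon
  have h2 := h.trans hV
  rw [ENNReal.ofReal_le_ofReal_iff hκ.le] at h2
  have : 8 * stC * κ / t * (t - t / 2) / (2 * stC) = 2 * κ := by field_simp; ring
  linarith

theorem ball_vol (x : Euc N) {r : ℝ} (hr : 0 < r) :
    volume (ball x r) = ENNReal.ofReal r ^ N * volume (ball (0 : Euc N) 1) := by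
  rw [Measure.addHaar_ball_of_pos _ _ hr, finrank_euclideanSpace_fin, ENNReal.ofReal_pow hr.le]

theorem v_ne_zero : volume (ball (0 : Euc N) 1) ≠ 0 :=
  (measure_ball_pos _ _ one_pos).ne'

theorem v_ne_top : volume (ball (0 : Euc N) 1) ≠ ⊤ := measure_ball_lt_top.ne

theorem ball_scale (x y : Euc N) {r c : ℝ} (hr : 0 < r) (hc : 0 < c) :
    volume (ball x (c * r)) = ENNReal.ofReal c ^ N * volume (ball y r) := by
  rw [ball_vol x (by positivity), ball_vol y hr, ENNReal.ofReal_mul hc.le, mul_pow, mul_assoc]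

theorem iso_lower (N : ℕ) {α : ℝ} (hα : 0 < α) : ∃ C : ℝ≥0∞, C ≠ ⊤ ∧
    ∀ E : Set (Euc N), MeasurableSet E → volume E ≠ ⊤ → ∀ (x : Euc N) (r : ℝ), 0 < r →
      ENNReal.ofReal α * volume (ball x r) ≤ volume (E ∩ ball x r) →
      ENNReal.ofReal α * volume (ball x r) ≤ volume (ball x r \ E) →
      ENNReal.ofReal (3 * r) ^ ((N : ℝ) - 1) ≤ C * variation (E.indicator 1) (ball x (3 * r)) := by
  set a := ENNReal.ofReal α with ha
  have ha0 : a ≠ 0 := (ENNReal.ofReal_pos.2 hα).ne'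
  have haT : a ≠ ⊤ := ENNReal.ofReal_ne_top
  set v := volume (ball (0 : Euc N) 1) with hv
  have hv0 : v ≠ 0 := v_ne_zero
  have hvT : v ≠ ⊤ := v_ne_top
  have h30 : ENNReal.ofReal 3 ≠ 0 := by simp
  refine ⟨ENNReal.ofReal 3 ^ ((N : ℝ) - 1) * ((a * a * v)⁻¹ * (2 * ENNReal.ofReal 2 ^ N)), ?_, ?_⟩
  · refine ENNReal.mul_ne_top (ENNReal.rpow_ne_top_of_ne_zero h30 ENNReal.ofReal_ne_top) 
      (ENNReal.mul_ne_top (ENNReal.inv_ne_top.2 ?_) ?_)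
    · exact mul_ne_zero (mul_ne_zero ha0 ha0) hv0
    · exact ENNReal.mul_ne_top (by simp) (ENNReal.pow_ne_top ENNReal.ofReal_ne_top)
  intro E hE hEf x r hr h1 h2
  have h3 := rel_isoperimetric hE hEf x hr
  set V := variation (E.indicator 1) (ball x (3 * r)) with hV
  set R := ENNReal.ofReal r with hR
  have hR0 : R ≠ 0 := (ENNReal.ofReal_pos.2 hr).ne'
  have hRT : R ≠ ⊤ := ENNReal.ofReal_ne_top
  rw [ball_scale x x hr (by norm_num : (0 : ℝ) < 2), ENNReal.ofReal_mul (by norm_num)] at h3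
  set b := volume (ball x r) with hb
  have hb0 : b ≠ 0 := (measure_ball_pos _ _ hr).ne'
  have hbT : b ≠ ⊤ := measure_ball_lt_top.ne
  have h4 : (a * a * b) * b ≤ (ENNReal.ofReal 2 * R * V * ENNReal.ofReal 2 ^ N) * b := by
    calc (a * a * b) * b = (a * b) * (a * b) := by ring
      _ ≤ _ := mul_le_mul' h1 h2
      _ ≤ _ := h3
      _ = _ := by ring
  rw [ENNReal.mul_le_mul_iff_left hb0 hbT] at h4
  have hbR : b = R ^ ((N : ℝ) - 1) * R * v := by
    rw [hb, ball_vol x hr, ENNReal.rpow_sub _ _ hR0 hRT, ENNReal.rpow_one, ENNReal.rpow_natCast,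
      ENNReal.div_mul_cancel hR0 hRT]
  have h5 : (a * a * v * R ^ ((N : ℝ) - 1)) * R ≤ (2 * ENNReal.ofReal 2 ^ N * V) * R := by
    calc _ = a * a * b := by rw [hbR]; ring
      _ ≤ _ := h4
      _ = _ := by rw [ENNReal.ofReal_ofNat]; ring
  rw [ENNReal.mul_le_mul_iff_left hR0 hRT] at h5
  have hA0 : a * a * v ≠ 0 := mul_ne_zero (mul_ne_zero ha0 ha0) hv0
  have hAT : a * a * v ≠ ⊤ := ENNReal.mul_ne_top (ENNReal.mul_ne_top haT haT) hvT
  rw [ENNReal.ofReal_mul (by norm_num), ENNReal.mul_rpow_of_ne_zero h30 hR0, mul_assoc, mul_assoc]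
  refine mul_le_mul' le_rfl ?_
  calc R ^ ((N : ℝ) - 1) = (a * a * v)⁻¹ * (a * a * v * R ^ ((N : ℝ) - 1)) := by
        rw [← mul_assoc, ENNReal.inv_mul_cancel hA0 hAT, one_mul]
    _ ≤ _ := mul_le_mul' le_rfl h5

/-- density threshold -/
def dl (N : ℕ) : ℝ := 1 / (2 * 6 ^ N)
theorem dl_pos (N : ℕ) : 0 < dl N := by unfold dl; positivity
theorem dl_le (N : ℕ) : dl N ≤ 1 / 2 := by
  unfold dl
  apply one_div_le_one_div_of_le (by norm_num)
  have : (1 : ℝ) ≤ 6 ^ N := one_le_pow₀ (by norm_num)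
  linarith

/-- points at which all density quotients up to scale one are small -/
def lowSet (E : Set (Euc N)) : Set (Euc N) :=
  {x | ∀ r : ℝ, 0 < r → r ≤ 1 → volume (E ∩ ball x r) ≤ ENNReal.ofReal (dl N) * volume (ball x r)}

theorem integrable_ind {E : Set (Euc N)} (hE : MeasurableSet E) (hEf : volume E ≠ ⊤) :
    Integrable (E.indicator (1 : Euc N → ℝ)) :=
  (integrable_indicator_iff hE).2 (integrableOn_const hEf)

theorem moll_small {E : Set (Euc N)} (hE : MeasurableSet E) (hEf : volume E ≠ ⊤) {k x : Euc N}
    (hk : k ∈ lowSet E) {n : ℕ} (hn : 3 * (1 / ((n : ℝ) + 1)) ≤ 1)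
    (hx : dist x k ≤ 2 * (1 / ((n : ℝ) + 1))) :
    moll (bmp N n) (E.indicator 1) x ≤ 1 / 2 := by
  set r := 1 / ((n : ℝ) + 1) with hr
  have hr0 : 0 < r := by positivity
  rw [moll_apply]
  have hbd : ∀ z, (bmp N n).normed volume (x - z) * (E.indicator 1 z : ℝ) ≤
      (2 ^ N / volume.real (closedBall (0 : Euc N) r)) * ((E ∩ ball k (3 * r)).indicator 1 z : ℝ) := by
    intro z
    by_cases hzE : z ∈ E
    · by_cases hz : dist z x < r
      · have hzk : z ∈ E ∩ ball k (3 * r) := ⟨hzE, by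
          rw [mem_ball]; linarith [dist_triangle z x k]⟩
        rw [indicator_of_mem hzE, indicator_of_mem hzk]
        simp only [Pi.one_apply, mul_one]
        have := (bmp N n).normed_le_div_measure_closedBall_rOut (μ := (volume : Measure (Euc N)))
          (K := 2) (by rw [bmp_rOut, bmp_rIn]; apply le_of_eq; field_simp) (x - z)
        rwa [finrank_euclideanSpace_fin] at this
      · have : (bmp N n).normed volume (x - z) = 0 := by
          have : x - z ∉ Function.support ((bmp N n).normed (volume : Measure (Euc N))) := by
            rw [(bmp N n).support_normed_eq, mem_ball, dist_zero_right, ← dist_eq_norm, dist_comm]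
            exact hz
          simpa using this
        rw [this, zero_mul]
        refine mul_nonneg (by positivity) (indicator_nonneg (by simp) _)
    · rw [indicator_of_notMem hzE, mul_zero]
      refine mul_nonneg (by positivity) (indicator_nonneg (by simp) _)
  have hEk : MeasurableSet (E ∩ ball k (3 * r)) := hE.inter measurableSet_ball
  have hEkf : volume (E ∩ ball k (3 * r)) ≠ ⊤ := measure_ne_top_of_subset inter_subset_left hEf
  have h1 : ∫ z, (bmp N n).normed volume (x - z) * (E.indicator 1 z : ℝ) ≤
      (2 ^ N / volume.real (closedBall (0 : Euc N) r)) * volume.real (E ∩ ball k (3 * r)) := by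
    rw [← integral_indicator_one hEk, ← integral_const_mul]
    refine integral_mono_of_nonneg (ae_of_all _ fun z => ?_)
      ((integrable_ind hEk hEkf).const_mul _) (ae_of_all _ hbd)
    exact mul_nonneg ((bmp N n).nonneg_normed _) (indicator_nonneg (by simp) _)
  refine h1.trans ?_
  have h2 := hk (3 * r) (by positivity) hn
  rw [ball_scale k 0 hr0 (by norm_num : (0 : ℝ) < 3)] at h2
  have hcb : volume (closedBall (0 : Euc N) r) = volume (ball (0 : Euc N) r) :=
    (Measure.addHaar_closedBall _ _ hr0.le).trans (Measure.addHaar_ball_of_pos _ _ hr0).symm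
  have h3 : volume.real (E ∩ ball k (3 * r)) ≤ dl N * (3 ^ N * volume.real (closedBall (0 : Euc N) r)) := by
    have hT : volume (ball (0 : Euc N) r) ≠ ⊤ := measure_ball_lt_top.ne
    have := ENNReal.toReal_mono (by finiteness) h2
    simpa [Measure.real, hcb, ENNReal.toReal_ofReal (dl_pos N).le] using this
  have hb : 0 < volume.real (closedBall (0 : Euc N) r) := by
    rw [Measure.real, hcb]
    exact ENNReal.toReal_pos (measure_ball_pos _ _ hr0).ne' measure_ball_lt_top.ne
  calc (2 ^ N / volume.real (closedBall (0 : Euc N) r)) * volume.real (E ∩ ball k (3 * r))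
      ≤ (2 ^ N / volume.real (closedBall (0 : Euc N) r)) *
        (dl N * (3 ^ N * volume.real (closedBall (0 : Euc N) r))) := by gcongr
    _ = 1 / 2 := by
      rw [dl, show (6 : ℝ) = 2 * 3 by norm_num, mul_pow]
      field_simp

theorem chain_set {E : Set (Euc N)} (hE : MeasurableSet E) (hEf : volume E ≠ ⊤) {U : Set (Euc N)}
    (hU : IsOpen U) : variation (E.indicator 1) U ≤
      ENNReal.ofReal (2 * stC) * variation (E.indicator 1) (U \ lowSet E) := by
  have hC := stC_pos
  refine variation_le fun ψ hψ => ?_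
  set φ : ℝ → ℝ := fun τ => Real.smoothTransition (2 * τ - 1) with hφ
  have hder : ∀ τ, deriv φ τ = 2 * deriv Real.smoothTransition (2 * τ - 1) := by
    intro τ
    have h1 : HasDerivAt Real.smoothTransition (deriv Real.smoothTransition (2 * τ - 1))
        (2 * τ - 1) :=
      ((Real.smoothTransition.contDiff (n := 1)).differentiable (by norm_num) _).hasDerivAt
    have h2 : HasDerivAt (fun τ : ℝ => 2 * τ - 1) (2 * 1) τ :=
      ((hasDerivAt_id τ).const_mul 2).sub_const 1
    have h3 := h1.comp τ h2
    have h4 : HasDerivAt φ _ τ := h3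
    rw [h4.deriv]; ring
  have main := chain_main (integrable_ind hE hEf) (Finset.univ : Finset Unit) (fun _ => φ)
    (fun _ => Real.smoothTransition.contDiff.comp (by fun_prop)) 1 (fun _ τ => by
      rw [hφ]; simp only
      rw [abs_of_nonneg (Real.smoothTransition.nonneg _)]
      exact Real.smoothTransition.le_one _) (L := 2 * stC) (by positivity) (fun τ => by
      simp only [Finset.univ_unique, Finset.sum_singleton]
      rw [hder, abs_mul, abs_two]
      exact mul_le_mul_of_nonneg_left (stC_bound _) (by norm_num))
    (fun _ => ψ) (fun _ => hψ.1) (fun _ => hψ.2.1) (fun _ => hψ.2.2.2) (U \ lowSet E) ?_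
  · simp only [Finset.univ_unique, Finset.sum_singleton] at main
    have e : ∀ x, φ (E.indicator 1 x) = (E.indicator 1 x : ℝ) := by
      intro x
      by_cases hx : x ∈ E
      · simp only [indicator_of_mem hx, hφ, Pi.one_apply]
        rw [Real.smoothTransition.one_of_one_le (by norm_num)]
      · simp only [indicator_of_notMem hx, hφ]
        rw [Real.smoothTransition.zero_of_nonpos (by norm_num)]
    simpa only [e] using main
  · obtain ⟨d, hd, hdU⟩ := IsCompact.exists_cthickening_subset_open hψ.2.1 hU hψ.2.2.1
    have hlim : Tendsto (fun n : ℕ => 1 / ((n : ℝ) + 1)) atTop (𝓝 0) :=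
      tendsto_one_div_add_atTop_nhds_zero_nat
    filter_upwards [hlim.eventually (gt_mem_nhds hd),
      hlim.eventually (gt_mem_nhds (by norm_num : (0 : ℝ) < 1 / 3))] with n hn1 hn2
    intro x hx y hy
    simp only [Finset.univ_unique, Finset.sum_singleton] at hx
    constructor
    · apply hdU
      have hxs : x ∈ tsupport ψ := by
        refine closure_mono ?_ hx
        intro z hz hz0
        exact hz (by simp [hz0])
      exact mem_cthickening_of_dist_le y x d _ hxs (le_trans hy hn1.le)
    · intro hyK
      rw [tsupport, Metric.mem_closure_iff] at hx
      obtain ⟨z, hz, hxz⟩ := hx (1 / ((n : ℝ) + 1)) (by positivity)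
      apply hz
      have hzy : dist z y ≤ 2 * (1 / ((n : ℝ) + 1)) := by
        have h1 : dist y x ≤ 1 / ((n : ℝ) + 1) := hy
        have := dist_triangle z x y
        rw [dist_comm z x, dist_comm x y] at this
        linarith
      have h2 := moll_small hE hEf hyK (by linarith) hzy
      simp only
      rw [hder, st_deriv_zero (Or.inl (by linarith)), mul_zero, zero_smul]

theorem compl_half {E : Set (Euc N)} {x : Euc N} {r : ℝ} (hE : MeasurableSet E)
    (h : volume (E ∩ ball x r) ≤ ENNReal.ofReal (dl N) * volume (ball x r)) {α : ℝ} 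
    (hα2 : α ≤ 1 / 2) : ENNReal.ofReal α * volume (ball x r) ≤ volume (ball x r \ E) := by
  have hT : volume (ball x r) ≠ ⊤ := measure_ball_lt_top.ne
  have h1 : volume (ball x r) = volume (E ∩ ball x r) + volume (ball x r \ E) := by
    rw [inter_comm, measure_inter_add_sdiff _ hE]
  have h2 : ENNReal.ofReal (1 / 2) * volume (ball x r) + ENNReal.ofReal (1 / 2) * volume (ball x r)
      = volume (ball x r) := by
    rw [← add_mul, ← ENNReal.ofReal_add (by norm_num) (by norm_num)]; norm_num
  have h3 : volume (E ∩ ball x r) ≤ ENNReal.ofReal (1 / 2) * volume (ball x r) :=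
    h.trans (mul_le_mul' (ENNReal.ofReal_le_ofReal (dl_le N)) le_rfl)
  have h4 : ENNReal.ofReal α * volume (ball x r) ≤ ENNReal.ofReal (1 / 2) * volume (ball x r) :=
    mul_le_mul' (ENNReal.ofReal_le_ofReal hα2) le_rfl
  refine h4.trans ?_
  have hfin : ENNReal.ofReal (1 / 2) * volume (ball x r) ≠ ⊤ :=
    ENNReal.mul_ne_top ENNReal.ofReal_ne_top hT
  refine (ENNReal.add_le_add_iff_left hfin).1 ?_
  rw [h2]
  nth_rewrite 1 [h1]
  gcongr

theorem exists_complement_small {E : Set (Euc N)} (hE : MeasurableSet E) (hEf : volume E ≠ ⊤)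
    (hV : variation (E.indicator 1) univ ≠ ⊤) {η : ℝ≥0∞} (hη : η ≠ 0) :
    ∃ U : Set (Euc N), IsOpen U ∧ lowSet E ⊆ U ∧
      variation (E.indicator 1) U ≤ ENNReal.ofReal (2 * stC) * η := by
  set W := variation (E.indicator 1) (lowSet E)ᶜ with hW
  have hWT : W ≠ ⊤ := ((variation_mono _ (subset_univ _)).trans_lt hV.lt_top).ne
  obtain ⟨ψ, hψ, hψW⟩ : ∃ ψ ∈ TestVF (lowSet E)ᶜ,
      W ≤ ENNReal.ofReal (∫ x, (E.indicator 1 x : ℝ) * diverg ψ x) + η := by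
    by_cases hW0 : W = 0
    · exact ⟨0, zero_TestVF _, by rw [hW0]; exact zero_le⟩
    · have h1 : W - η < W := ENNReal.sub_lt_self hWT hW0 hη
      nth_rewrite 2 [hW] at h1
      rw [variation] at h1
      obtain ⟨ψ, hψ⟩ := lt_iSup_iff.1 h1
      obtain ⟨hψT, hψ⟩ := lt_iSup_iff.1 hψ
      rw [setIntegral_testVF _ hψT] at hψ
      exact ⟨ψ, hψT, tsub_le_iff_right.1 hψ.le⟩
  refine ⟨(tsupport ψ)ᶜ, (isClosed_tsupport ψ).isOpen_compl, ?_, ?_⟩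
  · exact subset_compl_comm.1 hψ.2.2.1
  · refine (chain_set hE hEf (isClosed_tsupport ψ).isOpen_compl).trans (mul_le_mul' le_rfl ?_)
    have hd : Disjoint (tsupport ψ) ((tsupport ψ)ᶜ \ lowSet E) :=
      disjoint_compl_right.mono_right sdiff_subset
    have h1 := variation_superadd (integrable_ind hE hEf) hd
    have h2 : variation (E.indicator 1) (tsupport ψ ∪ (tsupport ψ)ᶜ \ lowSet E) ≤ W := by
      refine variation_mono _ (union_subset hψ.2.2.1 fun x hx => hx.2)
    have h3 : ENNReal.ofReal (∫ x, (E.indicator 1 x : ℝ) * diverg ψ x) ≤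
        variation (E.indicator 1) (tsupport ψ) :=
      le_variation _ ⟨hψ.1, hψ.2.1, subset_rfl, hψ.2.2.2⟩
    have h4 : variation (E.indicator 1) (tsupport ψ) ≠ ⊤ :=
      ((variation_mono _ (subset_univ _)).trans_lt hV.lt_top).ne
    refine (ENNReal.add_le_add_iff_left h4).1 ?_
    refine (h1.trans h2).trans (hψW.trans ?_)
    gcongr

theorem frequent_null (hN : 1 ≤ N) {E : Set (Euc N)} (hE : MeasurableSet E) (hEf : volume E ≠ ⊤)
    (hV : variation (E.indicator 1) univ ≠ ⊤) {α : ℝ} (hα : 0 < α) (hα2 : α ≤ 1 / 2) :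
    hcont N {x | x ∈ lowSet E ∧ ∃ᶠ r in 𝓝[>] (0 : ℝ),
      ENNReal.ofReal α * volume (ball x r) ≤ volume (E ∩ ball x r)} = 0 := by
  obtain ⟨C, hCT, hC⟩ := iso_lower N hα
  set S := {x | x ∈ lowSet E ∧ ∃ᶠ r in 𝓝[>] (0 : ℝ),
      ENNReal.ofReal α * volume (ball x r) ≤ volume (E ∩ ball x r)} with hS
  set A := (10 : ℝ≥0∞) ^ ((N : ℝ) - 1) * (C * ENNReal.ofReal (2 * stC)) with hA
  have hAT : A ≠ ⊤ := ENNReal.mul_ne_top (ENNReal.rpow_ne_top_of_ne_zero (by simp) (by simp))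
    (ENNReal.mul_ne_top hCT ENNReal.ofReal_ne_top)
  have key : ∀ η : ℝ≥0∞, η ≠ 0 → hcont N S ≤ A * η := by
    intro η hη
    obtain ⟨U, hU, hKU, hUη⟩ := exists_complement_small hE hEf hV hη
    have hr : ∀ x, ∃ r : ℝ, x ∈ S → 0 < r ∧ r ≤ 1 ∧ closedBall x (3 * r) ⊆ U ∧
        ENNReal.ofReal α * volume (ball x r) ≤ volume (E ∩ ball x r) := by
      intro x
      by_cases hx : x ∈ S
      · obtain ⟨d, hd, hdU⟩ := Metric.isOpen_iff.1 hU x (hKU hx.1)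
        have hm : Ioo (0 : ℝ) (min 1 (d / 3)) ∈ 𝓝[>] (0 : ℝ) := Ioo_mem_nhdsGT (by positivity)
        obtain ⟨r, hr1, hr2⟩ := (hx.2.and_eventually hm).exists
        have h3 := lt_min_iff.1 hr2.2
        exact ⟨r, fun _ => ⟨hr2.1, h3.1.le,
          (closedBall_subset_ball (by linarith [h3.2])).trans hdU, hr1⟩⟩
      · exact ⟨0, fun h => absurd h hx⟩
    choose r hr using hr
    have := hcont_cover hN S (fun x => 3 * r x) 3 (fun x hx => by
        have := hr x hx; constructor <;> linarith [this.1, this.2.1])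
      (C * (ENNReal.ofReal (2 * stC) * η)) ?_
    · refine this.trans (le_of_eq ?_)
      rw [hA]; ring
    · intro F hF hFd
      calc ∑ x ∈ F, ENNReal.ofReal (3 * r x) ^ ((N : ℝ) - 1)
          ≤ ∑ x ∈ F, C * variation (E.indicator 1) (closedBall x (3 * r x)) := by
            refine Finset.sum_le_sum fun x hx => ?_
            obtain ⟨h1, h2, h3, h4⟩ := hr x (hF x hx)
            have hl := (hF x hx).1 (r x) h1 h2
            refine (hC E hE hEf x (r x) h1 h4 (compl_half hE hl hα2)).trans ?_
            exact mul_le_mul' le_rfl (variation_mono _ ball_subset_closedBall)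
        _ = C * ∑ x ∈ F, variation (E.indicator 1) (closedBall x (3 * r x)) := by
            rw [Finset.mul_sum]
        _ ≤ C * variation (E.indicator 1) U := by
            refine mul_le_mul' le_rfl ((variation_sum (integrable_ind hE hEf) _ F hFd).trans ?_)
            refine variation_mono _ (iUnion₂_subset fun x hx => (hr x (hF x hx)).2.2.1)
        _ ≤ _ := mul_le_mul' le_rfl hUη
  have hlim : Tendsto (fun n : ℕ => A * ((n : ℝ≥0∞))⁻¹) atTop (𝓝 (A * 0)) :=
    ENNReal.Tendsto.const_mul ENNReal.tendsto_inv_nat_nhds_zero (Or.inr hAT)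
  rw [mul_zero] at hlim
  exact le_antisymm (ge_of_tendsto hlim (Eventually.of_forall fun n => key _ (by simp))) zero_le

theorem low_null (hN : 1 ≤ N) {E : Set (Euc N)} (hE : MeasurableSet E) (hEf : volume E ≠ ⊤)
    (hV : variation (E.indicator 1) univ ≠ ⊤) :
    hcont N {x | x ∈ lowSet E ∧ ¬ HasDensity E x 0} = 0 := by
  have hsub : {x | x ∈ lowSet E ∧ ¬ HasDensity E x 0} ⊆ ⋃ m : ℕ,
      {x | x ∈ lowSet E ∧ ∃ᶠ r in 𝓝[>] (0 : ℝ),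
      ENNReal.ofReal (1 / ((m : ℝ) + 2)) * volume (ball x r) ≤ volume (E ∩ ball x r)} := by
    rintro x ⟨hx, hd⟩
    rw [HasDensity, ENNReal.ofReal_zero, ENNReal.tendsto_nhds_zero] at hd
    push Not at hd
    obtain ⟨ε, hε, hfr⟩ := hd
    have hlim : Tendsto (fun m : ℕ => ENNReal.ofReal (1 / ((m : ℝ) + 2))) atTop (𝓝 0) := by
      rw [← ENNReal.ofReal_zero]
      refine (ENNReal.continuous_ofReal.tendsto 0).comp ?_
      have := (tendsto_one_div_add_atTop_nhds_zero_nat (𝕜 := ℝ)).comp (tendsto_add_atTop_nat 1)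
      refine this.congr fun m => ?_
      simp only [Function.comp]; push_cast; ring
    obtain ⟨m, hm⟩ := (hlim.eventually (gt_mem_nhds hε)).exists
    refine mem_iUnion.2 ⟨m, hx, ?_⟩
    refine (hfr.and_eventually (self_mem_nhdsWithin : Ioi (0 : ℝ) ∈ 𝓝[>] 0)).mono ?_
    rintro r ⟨h1, h2⟩
    have hr : (0 : ℝ) < r := h2
    have := (hm.trans h1).le
    rwa [ENNReal.le_div_iff_mul_le (Or.inl (measure_ball_pos _ _ hr).ne')
      (Or.inl measure_ball_lt_top.ne)] at this
  refine measure_mono_null hsub (measure_iUnion_null fun m => ?_)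
  refine frequent_null hN hE hEf hV (by positivity) ?_
  apply one_div_le_one_div_of_le (by norm_num)
  linarith [(Nat.cast_nonneg m : (0 : ℝ) ≤ m)]

theorem boxing (hN : 1 ≤ N) : ∃ C : ℝ≥0∞, C ≠ ⊤ ∧ ∀ E : Set (Euc N), MeasurableSet E →
    volume E ≠ ⊤ → hcont N (lowSet E)ᶜ ≤ C * (variation (E.indicator 1) univ + volume E) := by
  have hdl := dl_pos N
  have hα : 0 < dl N * (1 / 2) ^ N := by positivity
  have hα2 : dl N * (1 / 2) ^ N ≤ 1 / 2 := by
    refine le_trans (mul_le_of_le_one_right hdl.le ?_) (dl_le N)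
    exact pow_le_one₀ (by norm_num) (by norm_num)
  obtain ⟨C₁, hC₁T, hC₁⟩ := iso_lower N hα
  have hN' : (0 : ℝ) ≤ (N : ℝ) - 1 := by
    have : (1 : ℝ) ≤ N := by exact_mod_cast hN
    linarith
  set β := ENNReal.ofReal (dl N) * volume (ball (0 : Euc N) (1 / 2)) with hβ
  have hβ0 : β ≠ 0 := mul_ne_zero (ENNReal.ofReal_pos.2 hdl).ne' (measure_ball_pos _ _ (by norm_num)).ne'
  have hβT : β ≠ ⊤ := ENNReal.mul_ne_top ENNReal.ofReal_ne_top measure_ball_lt_top.ne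
  set C₂ := ENNReal.ofReal 3 ^ ((N : ℝ) - 1) * β⁻¹ with hC₂
  have hC₂T : C₂ ≠ ⊤ := ENNReal.mul_ne_top (ENNReal.rpow_ne_top_of_nonneg hN' ENNReal.ofReal_ne_top)
    (ENNReal.inv_ne_top.2 hβ0)
  refine ⟨10 ^ ((N : ℝ) - 1) * (C₁ + C₂), ENNReal.mul_ne_top
    (ENNReal.rpow_ne_top_of_nonneg hN' (by simp)) (ENNReal.add_ne_top.2 ⟨hC₁T, hC₂T⟩), ?_⟩
  intro E hE hEf
  have key : ∀ x, ∃ ρ : ℝ, x ∈ (lowSet E)ᶜ → (0 < ρ ∧ ρ ≤ 3) ∧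
      ENNReal.ofReal ρ ^ ((N : ℝ) - 1) ≤ (C₁ + C₂) *
        (variation (E.indicator 1) (closedBall x ρ) + volume (E ∩ closedBall x ρ)) := by
    intro x
    by_cases hx : x ∈ (lowSet E)ᶜ
    swap
    · exact ⟨0, fun h => absurd h hx⟩
    set A : Set ℝ := {r | 0 < r ∧ r ≤ 1 ∧
      ENNReal.ofReal (dl N) * volume (ball x r) < volume (E ∩ ball x r)} with hA
    have hne : A.Nonempty := by
      simp only [mem_compl_iff, lowSet, mem_ofPred_eq] at hx
      push Not at hx
      obtain ⟨r, h1, h2, h3⟩ := hx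
      exact ⟨r, h1, h2, h3⟩
    have hbdd : BddAbove A := ⟨1, fun r hr => hr.2.1⟩
    obtain ⟨r₀, hr₀⟩ := hne
    have hsup : 0 < sSup A := lt_of_lt_of_le hr₀.1 (le_csSup hbdd hr₀)
    obtain ⟨r, hrA, hr⟩ := exists_lt_of_lt_csSup ⟨r₀, hr₀⟩ (show sSup A / 2 < sSup A by linarith)
    obtain ⟨hr0, hr1, hr2⟩ := hrA
    by_cases h2r : 2 * r ≤ 1
    · have hnot : 2 * r ∉ A := fun h => by
        have := le_csSup hbdd h; linarith
      have h3 : volume (E ∩ ball x (2 * r)) ≤ ENNReal.ofReal (dl N) * volume (ball x (2 * r)) := by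
        by_contra hcon
        exact hnot ⟨by linarith, h2r, not_le.1 hcon⟩
      have h4 : ENNReal.ofReal (dl N * (1 / 2) ^ N) * volume (ball x (2 * r)) ≤
          volume (E ∩ ball x (2 * r)) := by
        calc ENNReal.ofReal (dl N * (1 / 2) ^ N) * volume (ball x (2 * r))
            = ENNReal.ofReal (dl N) * volume (ball x r) := by
              have := ball_scale x x (by linarith : (0 : ℝ) < 2 * r) (by norm_num : (0 : ℝ) < 1 / 2)
              rw [show (1 : ℝ) / 2 * (2 * r) = r by ring] at this
              rw [this, ENNReal.ofReal_mul hdl.le, ENNReal.ofReal_pow (by norm_num), mul_assoc]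
          _ ≤ volume (E ∩ ball x r) := hr2.le
          _ ≤ _ := measure_mono (inter_subset_inter_right _ (ball_subset_ball (by linarith)))
      have h5 := hC₁ E hE hEf x (2 * r) (by linarith) h4 (compl_half hE h3 hα2)
      refine ⟨3 * (2 * r), fun _ => ⟨⟨by linarith, by linarith⟩, h5.trans ?_⟩⟩
      refine mul_le_mul' le_self_add (le_trans (variation_mono _ ball_subset_closedBall) le_self_add)
    · refine ⟨3 * r, fun _ => ⟨⟨by linarith, by linarith⟩, ?_⟩⟩
      have h1 : β ≤ volume (E ∩ closedBall x (3 * r)) := by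
        calc β = ENNReal.ofReal (dl N) * volume (ball x (1 / 2)) := by
              rw [hβ, Measure.addHaar_ball_center volume x]
          _ ≤ ENNReal.ofReal (dl N) * volume (ball x r) :=
              mul_le_mul' le_rfl (measure_mono (ball_subset_ball (by linarith)))
          _ ≤ _ := hr2.le
          _ ≤ _ := measure_mono (inter_subset_inter_right _
              ((ball_subset_ball (by linarith)).trans ball_subset_closedBall))
      calc ENNReal.ofReal (3 * r) ^ ((N : ℝ) - 1) ≤ ENNReal.ofReal 3 ^ ((N : ℝ) - 1) := by
            exact ENNReal.rpow_le_rpow (ENNReal.ofReal_le_ofReal (by linarith)) hN'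
        _ = C₂ * β := by
            rw [hC₂, mul_assoc, ENNReal.inv_mul_cancel hβ0 hβT, mul_one]
        _ ≤ _ := mul_le_mul' le_add_self (h1.trans le_add_self)
  choose ρ hρ using key
  rw [mul_assoc]
  refine hcont_cover hN _ ρ 3 (fun x hx => (hρ x hx).1) _ ?_
  intro F hF hFd
  calc ∑ x ∈ F, ENNReal.ofReal (ρ x) ^ ((N : ℝ) - 1)
      ≤ ∑ x ∈ F, (C₁ + C₂) *
        (variation (E.indicator 1) (closedBall x (ρ x)) + volume (E ∩ closedBall x (ρ x))) :=
        Finset.sum_le_sum fun x hx => (hρ x (hF x hx)).2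
    _ = (C₁ + C₂) * (∑ x ∈ F, variation (E.indicator 1) (closedBall x (ρ x)) +
          ∑ x ∈ F, volume (E ∩ closedBall x (ρ x))) := by
        rw [← Finset.mul_sum, Finset.sum_add_distrib]
    _ ≤ _ := by
        refine mul_le_mul' le_rfl (add_le_add ?_ ?_)
        · exact (variation_sum (integrable_ind hE hEf) _ F hFd).trans
            (variation_mono _ (subset_univ _))
        · rw [← measure_biUnion_finset]
          · exact measure_mono (iUnion₂_subset fun x _ => inter_subset_left)
          · exact hFd.mono fun x => inter_subset_right
          · exact fun x _ => hE.inter measurableSet_closedBall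

theorem HasDensity_mono {A B : Set (Euc N)} (h : A ⊆ B) {x : Euc N} (hB : HasDensity B x 0) :
    HasDensity A x 0 := by
  rw [HasDensity, ENNReal.ofReal_zero] at *
  refine tendsto_of_tendsto_of_tendsto_of_le_of_le tendsto_const_nhds hB (fun _ => zero_le) fun r => ?_
  exact ENNReal.div_le_div_right (measure_mono (inter_subset_inter_left _ h)) _

theorem HasDensity_union {A B : Set (Euc N)} {x : Euc N} (hA : HasDensity A x 0)
    (hB : HasDensity B x 0) : HasDensity (A ∪ B) x 0 := by
  rw [HasDensity, ENNReal.ofReal_zero] at *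
  have := hA.add hB
  rw [add_zero] at this
  refine tendsto_of_tendsto_of_tendsto_of_le_of_le tendsto_const_nhds this (fun _ => zero_le) fun r => ?_
  simp only
  rw [← ENNReal.add_div, union_inter_distrib_right]
  exact ENNReal.div_le_div_right (measure_union_le _ _) _

theorem HasDensity_congr {A B : Set (Euc N)} (h : A =ᵐ[volume] B) {x : Euc N} {t : ℝ}
    (hA : HasDensity A x t) : HasDensity B x t := by
  refine Tendsto.congr (fun r => ?_) hA
  rw [measure_congr (h.inter (ae_eq_refl (ball x r)))]

theorem capacity (hN : 1 ≤ N) : ∃ C : ℝ≥0∞, C ≠ ⊤ ∧ ∀ w : Euc N → ℝ, Integrable w →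
    ∀ t κ : ℝ, 0 < t → 0 < κ → eLpNorm w 1 volume + variation w univ ≤ ENNReal.ofReal κ →
    hcont N {x | ¬ HasDensity {y | t < w y} x 0} ≤ C * ENNReal.ofReal (κ / t) := by
  obtain ⟨C, hCT, hC⟩ := boxing hN
  have hst := stC_pos
  refine ⟨C * ENNReal.ofReal (8 * stC + 2), ENNReal.mul_ne_top hCT ENNReal.ofReal_ne_top, ?_⟩
  -- reduce to measurable functions
  suffices H : ∀ w : Euc N → ℝ, Measurable w → Integrable w →
      ∀ t κ : ℝ, 0 < t → 0 < κ → eLpNorm w 1 volume + variation w univ ≤ ENNReal.ofReal κ →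
      hcont N {x | ¬ HasDensity {y | t < w y} x 0} ≤
        C * ENNReal.ofReal (8 * stC + 2) * ENNReal.ofReal (κ / t) by
    intro w hw t κ ht hκ hb
    have hae := hw.1.ae_eq_mk
    have h1 := H (hw.1.mk w) hw.1.stronglyMeasurable_mk.measurable (hw.congr hae) t κ ht hκ
      (by rwa [← eLpNorm_congr_ae hae, ← variation_congr hae])
    have hset : {y | t < hw.1.mk w y} =ᵐ[volume] {y | t < w y} := by
      filter_upwards [hae] with y hy
      change (t < hw.1.mk w y) = (t < w y)
      rw [hy]
    have hsub : {x | ¬ HasDensity {y | t < w y} x 0} ⊆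
        {x | ¬ HasDensity {y | t < hw.1.mk w y} x 0} := by
      intro x hx hd
      exact hx (HasDensity_congr hset hd)
    exact le_trans (measure_mono hsub) h1
  intro w hm hw t κ ht hκ hb
  obtain ⟨s, hs, hsV⟩ := coarea_level hw ht hκ (le_add_self.trans hb)
  set E := {x | s < w x} with hEdef
  have hs0 : 0 < s := lt_of_lt_of_le (by linarith) hs.1
  have hE : MeasurableSet E := measurableSet_lt measurable_const hm
  have hEvol : volume E ≤ ENNReal.ofReal (2 * κ / t) := by
    have h1 := mul_meas_ge_le_lintegral₀ (μ := volume) (f := fun x => ‖w x‖ₑ) hm.enorm.aemeasurable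
      (ENNReal.ofReal s)
    have h2 : E ⊆ {x | ENNReal.ofReal s ≤ ‖w x‖ₑ} := by
      intro x hx
      have hx' : s < w x := hx
      change ENNReal.ofReal s ≤ ‖w x‖ₑ
      rw [← ofReal_norm]
      exact ENNReal.ofReal_le_ofReal (hx'.le.trans (le_abs_self _))
    have h3 : ENNReal.ofReal s * volume E ≤ ENNReal.ofReal κ := by
      refine (mul_le_mul' le_rfl (measure_mono h2)).trans (h1.trans ?_)
      rw [← eLpNorm_one_eq_lintegral_enorm]
      exact le_self_add.trans hb
    have h4 : volume E ≤ ENNReal.ofReal κ / ENNReal.ofReal s := by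
      rw [ENNReal.le_div_iff_mul_le (Or.inl (ENNReal.ofReal_pos.2 hs0).ne') (Or.inl ENNReal.ofReal_ne_top),
        mul_comm]
      exact h3
    refine h4.trans ?_
    rw [← ENNReal.ofReal_div_of_pos hs0]
    apply ENNReal.ofReal_le_ofReal
    rw [div_le_div_iff₀ hs0 ht]
    nlinarith [hs.1]
  have hEf : volume E ≠ ⊤ := (hEvol.trans_lt ENNReal.ofReal_lt_top).ne
  have hVT : variation (E.indicator 1) univ ≠ ⊤ := (hsV.trans_lt ENNReal.ofReal_lt_top).ne
  have hsub : {x | ¬ HasDensity {y | t < w y} x 0} ⊆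
      (lowSet E)ᶜ ∪ {x | x ∈ lowSet E ∧ ¬ HasDensity E x 0} := by
    intro x hx
    by_cases hxl : x ∈ lowSet E
    · right
      refine ⟨hxl, fun hd => hx (HasDensity_mono ?_ hd)⟩
      intro y hy
      exact lt_of_le_of_lt hs.2 hy
    · left; exact hxl
  refine (measure_mono hsub).trans ((measure_union_le _ _).trans ?_)
  rw [low_null hN hE hEf hVT, add_zero]
  refine (hC E hE hEf).trans ?_
  rw [mul_assoc]
  refine mul_le_mul' le_rfl ((add_le_add hsV hEvol).trans ?_)
  rw [← ENNReal.ofReal_add (by positivity) (by positivity), ← ENNReal.ofReal_mul (by positivity)]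
  apply ENNReal.ofReal_le_ofReal
  apply le_of_eq
  field_simp

theorem approxUpper_le_add {u v : Euc N → ℝ} {x : Euc N} {c : ℝ}
    (h : HasDensity {y | c < u y - v y} x 0) :
    approxUpper u univ x ≤ approxUpper v univ x + (c : EReal) := by
  have h1 : approxUpper u univ x - (c : EReal) ≤ approxUpper v univ x := by
    refine le_sInf ?_
    rintro _ ⟨s, rfl, hs⟩
    rw [EReal.sub_le_iff_le_add (Or.inl (EReal.coe_ne_bot c)) (Or.inl (EReal.coe_ne_top c))]
    refine sInf_le ⟨s + c, by push_cast; rfl, ?_⟩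
    refine HasDensity_mono ?_ (HasDensity_union hs h)
    rintro y ⟨_, hy⟩
    by_cases hv : s < v y
    · exact Or.inl ⟨mem_univ _, hv⟩
    · right
      change c < u y - v y
      linarith
  rwa [EReal.sub_le_iff_le_add (Or.inl (EReal.coe_ne_bot c)) (Or.inl (EReal.coe_ne_top c))] at h1

theorem ereal_squeeze {a : ℕ → EReal} {b : EReal} {c : ℕ → ℝ} (hc : Tendsto c atTop (𝓝 0))
    (h1 : ∀ᶠ j in atTop, a j ≤ b + (c j : EReal)) (h2 : ∀ᶠ j in atTop, b ≤ a j + (c j : EReal)) :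
    Tendsto a atTop (𝓝 b) := by
  have hup : Tendsto (fun j => b + (c j : EReal)) atTop (𝓝 b) := by
    have hc' : Tendsto (fun j => (c j : EReal)) atTop (𝓝 ((0 : ℝ) : EReal)) :=
      EReal.tendsto_coe.2 hc
    have := (EReal.continuousAt_add (p := (b, ((0 : ℝ) : EReal))) (Or.inr (EReal.coe_ne_bot 0))
      (Or.inr (EReal.coe_ne_top 0))).tendsto.comp (tendsto_const_nhds.prodMk_nhds hc')
    simpa [Function.comp_def] using this
  have hlo : Tendsto (fun j => b + ((-c j : ℝ) : EReal)) atTop (𝓝 b) := by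
    have hc' : Tendsto (fun j => ((-c j : ℝ) : EReal)) atTop (𝓝 ((0 : ℝ) : EReal)) :=
      EReal.tendsto_coe.2 (by simpa using hc.neg)
    have := (EReal.continuousAt_add (p := (b, ((0 : ℝ) : EReal))) (Or.inr (EReal.coe_ne_bot 0))
      (Or.inr (EReal.coe_ne_top 0))).tendsto.comp (tendsto_const_nhds.prodMk_nhds hc')
    simpa [Function.comp_def] using this
  refine tendsto_of_tendsto_of_tendsto_of_le_of_le' hlo hup ?_ h1
  filter_upwards [h2] with j hj
  rw [EReal.coe_neg, ← sub_eq_add_neg]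
  rwa [EReal.sub_le_iff_le_add (Or.inl (EReal.coe_ne_bot _)) (Or.inl (EReal.coe_ne_top _))]

theorem zero_dim {w : Euc 0 → ℝ} {t κ : ℝ} (hκt : κ < t)
    (hw : eLpNorm w 1 volume ≤ ENNReal.ofReal κ) (hκ : 0 < κ) (x : Euc 0) :
    HasDensity {y | t < w y} x 0 := by
  have hemp : {y | t < w y} = ∅ := by
    rw [eq_empty_iff_forall_notMem]
    intro y hy
    have hy' : t < w y := hy
    rw [eLpNorm_one_eq_lintegral_enorm] at hw
    have h1 : ∫⁻ z, ‖w z‖ₑ = ‖w y‖ₑ := by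
      have : ∀ z, w z = w y := fun z => by rw [Subsingleton.elim z y]
      simp only [this]
      rw [lintegral_const]
      have : volume (univ : Set (Euc 0)) = 1 := by
        rw [volume_euclideanSpace_eq_dirac]
        simp
      rw [this, mul_one]
    rw [h1, ← ofReal_norm, ENNReal.ofReal_le_ofReal_iff hκ.le] at hw
    have := le_abs_self (w y)
    rw [Real.norm_eq_abs] at hw
    linarith
  rw [hemp, HasDensity]
  simp

theorem density_ae (d : ℕ → Euc N → ℝ) (hd : ∀ j, Integrable (d j))
    (hb : ∀ j, eLpNorm (d j) 1 volume + variation (d j) univ ≤ ENNReal.ofReal ((1 / 4 : ℝ) ^ (j + 1))) :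
    ∀ᵐ x ∂(μH[(N : ℝ) - 1] : Measure (Euc N)), ∀ᶠ j in atTop,
      HasDensity {y | (1 / 2 : ℝ) ^ (j + 1) < d j y} x 0 := by
  rcases Nat.eq_zero_or_pos N with rfl | hN
  · refine ae_of_all _ fun x => Eventually.of_forall fun j => ?_
    refine zero_dim (κ := (1 / 4 : ℝ) ^ (j + 1)) ?_ (le_self_add.trans (hb j)) (by positivity) x
    exact pow_lt_pow_left₀ (by norm_num) (by norm_num) (by omega)
  · obtain ⟨C, hCT, hC⟩ := capacity hN
    have h1 : ∀ j, hcont N {x | ¬ HasDensity {y | (1 / 2 : ℝ) ^ (j + 1) < d j y} x 0} ≤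
        C * ENNReal.ofReal ((1 / 2 : ℝ) ^ (j + 1)) := by
      intro j
      have := hC (d j) (hd j) ((1 / 2 : ℝ) ^ (j + 1)) ((1 / 4 : ℝ) ^ (j + 1)) (by positivity)
        (by positivity) (hb j)
      rwa [← div_pow, show (1 / 4 : ℝ) / (1 / 2) = 1 / 2 by norm_num] at this
    have h2 : ∑' j, hcont N {x | ¬ HasDensity {y | (1 / 2 : ℝ) ^ (j + 1) < d j y} x 0} ≠ ⊤ := by
      refine ne_top_of_le_ne_top ?_ (ENNReal.tsum_le_tsum h1)
      rw [ENNReal.tsum_mul_left]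
      refine ENNReal.mul_ne_top hCT ?_
      have hsum : Summable fun j : ℕ => (1 / 2 : ℝ) ^ (j + 1) :=
        (summable_nat_add_iff 1).2 summable_geometric_two
      exact hsum.tsum_ofReal_ne_top
    have h3 := measure_limsup_atTop_eq_zero h2
    have h4 := hausdorff_zero_of_hcont hN h3
    refine measure_mono_null ?_ h4
    intro x hx
    rw [mem_limsup_iff_frequently_mem]
    exact fun hcon => hx (hcon.mono fun j hj => not_not.1 hj)

/-- if `{u_k} ⊆ BV(ℝ^N)` and `u ∈ BV(ℝ^N)` with
`‖u_k − u‖_BV = ‖u_k − u‖_{L¹} + V(u_k − u, ℝ^N) → 0`, then a subsequence satisfies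
`u_{k_j}⁺(x) → u⁺(x)` for `H^{N-1}`-a.e. `x`. -/
theorem statement12 {N : ℕ} (u : ℕ → Euc N → ℝ) (v : Euc N → ℝ)
    (hBV : ∀ k, MemBV (u k) Set.univ) (hvBV : MemBV v Set.univ)
    (hconv : Tendsto (fun k =>
        eLpNorm (fun x => u k x - v x) 1 volume +
          variation (fun x => u k x - v x) Set.univ) atTop (𝓝 0)) :
    ∃ φ : ℕ → ℕ, StrictMono φ ∧
      ∀ᵐ x ∂(μH[(N : ℝ) - 1] : Measure (Euc N)),
        Tendsto (fun j => approxUpper (u (φ j)) Set.univ x) atTop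
          (𝓝 (approxUpper v Set.univ x)) := by
  obtain ⟨φ, hφ, hb⟩ := extraction_forall_of_eventually (P := fun j k =>
      eLpNorm (fun x => u k x - v x) 1 volume + variation (fun x => u k x - v x) Set.univ ≤
        ENNReal.ofReal ((1 / 4 : ℝ) ^ (j + 1))) (fun j =>
      (hconv.eventually (ge_mem_nhds (ENNReal.ofReal_pos.2 (by positivity)))))
  refine ⟨φ, hφ, ?_⟩
  have hv : Integrable v := integrableOn_univ.1 hvBV.1
  have hu : ∀ k, Integrable (u k) := fun k => integrableOn_univ.1 (hBV k).1
  have e : ∀ k, (fun x => v x - u k x) = fun x => -(u k x - v x) := fun k => by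
    funext x; ring
  have A1 := density_ae (fun j x => u (φ j) x - v x) (fun j => (hu _).sub hv) hb
  have A2 := density_ae (fun j x => v x - u (φ j) x) (fun j => hv.sub (hu _)) (fun j => by
    rw [e, variation_neg]
    have : eLpNorm (fun x => -(u (φ j) x - v x)) 1 volume =
        eLpNorm (fun x => u (φ j) x - v x) 1 volume := eLpNorm_neg (fun x => u (φ j) x - v x) _ _
    rw [this]
    exact hb j)
  have hc : Tendsto (fun j : ℕ => (1 / 2 : ℝ) ^ (j + 1)) atTop (𝓝 0) :=
    (tendsto_pow_atTop_nhds_zero_of_lt_one (by norm_num) (by norm_num)).comp (tendsto_add_atTop_nat 1)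
  filter_upwards [A1, A2] with x h1 h2
  refine ereal_squeeze hc ?_ ?_
  · filter_upwards [h1] with j hj using approxUpper_le_add hj
  · filter_upwards [h2] with j hj using approxUpper_le_add hj
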